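/- Let d = 2 and let 𝒮 := {C ∈ 𝒫 : 𝔯(C) is squarefree}, i.e., the set of rational maps of degree 2 over ℚ whose resultant is a squarefree integer (in particular nonzero). Then for every n ∈ {1,…,6}, the n-th weak box density μ_n(𝒮) exists and μ_n(𝒮) > 0.327. -/

import Mathlib

open Filter MvPolynomial

noncomputable section

/-- The `2d × 2d` Sylvester matrix of the two generic binary forms of degree `d`,
with entries taken from the coordinates of `Q` (the first `d+1` coordinates of `Q`
are the coefficients of `F`, the last `d+1` ones those of `G`). -/
def sylvesterMat (d : ℕ) {R : Type*} [CommRing R] (Q : Fin (2 * d + 2) → R) :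
    Matrix (Fin (2 * d)) (Fin (2 * d)) R :=
  Matrix.of fun i j =>
    if hi : (i : ℕ) < d then
      if h : (i : ℕ) ≤ (j : ℕ) ∧ (j : ℕ) ≤ (i : ℕ) + d then
        Q ⟨(j : ℕ) - (i : ℕ), by omega⟩
      else 0
    else
      if h : (i : ℕ) - d ≤ (j : ℕ) ∧ (j : ℕ) ≤ (i : ℕ) then
        Q ⟨d + 1 + ((j : ℕ) - ((i : ℕ) - d)), by omega⟩
      else 0

/-- The generic resultant polynomial `𝔯 ∈ ℤ[x₀,…,x_d,y₀,…,y_d]`: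
the determinant of the Sylvester matrix of the generic binary forms of degree `d`. -/
def resPoly (d : ℕ) : MvPolynomial (Fin (2 * d + 2)) ℤ :=
  Matrix.det (sylvesterMat d fun i => X i)

/-- Evaluation `𝔯(Q)` of the generic resultant at a tuple `Q` with entries in a
commutative ring (i.e. evaluation of the image of `𝔯` under the coefficient map `ℤ → R`). -/
def resEval (d : ℕ) {R : Type*} [CommRing R] (Q : Fin (2 * d + 2) → R) : R :=
  aeval Q (resPoly d)

/-- The set `𝒫 ⊆ ℤ^{2d+2}` identified with `ℙ^{2d+1}(ℚ)`: integer tuples with gcd `1`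
whose first nonzero coordinate is positive. -/
def projPts (d : ℕ) : Set (Fin (2 * d + 2) → ℤ) :=
  {C | Finset.univ.gcd C = 1 ∧ ∃ i, 0 < C i ∧ ∀ j, j < i → C j = 0}

/-- The box of integer tuples with `|xᵢ| ≤ rᵢ` for all `i`. -/
def box {m : ℕ} (r : Fin m → ℝ) : Set (Fin m → ℤ) :=
  {x | ∀ i, |(x i : ℝ)| ≤ r i}

/-- The value `ζ(k)` of the Riemann zeta function at an integer `k` (for `k ≥ 2`). -/
def zetaVal (k : ℕ) : ℝ := ∑' n : ℕ+, (1 : ℝ) / ((n : ℕ) : ℝ) ^ k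

/-- The local factor `π_p^{(k)}`. -/
def piLocal (d p k : ℕ) : ℝ :=
  (Nat.card {Q : Fin (2 * d + 2) → ZMod (p ^ k) // resEval d Q ≠ 0} : ℝ) /
    ((p : ℝ) ^ ((2 * d + 2) * k) * (1 - 1 / (p : ℝ) ^ (2 * d + 2)))

/-- The ratio `#S(r⃗)/#𝒫(r⃗)` entering the weak box densities (for `d = 2`). -/
def weakRatio (d : ℕ) (S : Set (Fin (2 * d + 2) → ℤ)) (r : Fin (2 * d + 2) → ℝ) : ℝ :=
  (Nat.card ↥(S ∩ box r) : ℝ) / (Nat.card ↥(projPts d ∩ box r) : ℝ)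

/-- The set `𝒮` of degree-2 rational maps with squarefree resultant. -/
def sqfRes2 : Set (Fin (2 * 2 + 2) → ℤ) :=
  {C | C ∈ projPts 2 ∧ Squarefree (resEval 2 C)}

/-- The integers `v` with `|v| ≤ N`. -/
def symmIcc (N : ℕ) : Finset ℤ := Finset.Icc (-(N : ℤ)) N

lemma mem_symmIcc {N : ℕ} {v : ℤ} : v ∈ symmIcc N ↔ |v| ≤ N := by
  rw [symmIcc, Finset.mem_Icc, abs_le]

lemma card_symmIcc (N : ℕ) : ((symmIcc N).card : ℝ) = 2 * N + 1 := by
  have h : (symmIcc N).card = 2 * N + 1 := by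
    rw [symmIcc, Int.card_Icc]; omega
  rw [h]; push_cast; ring

open Classical in
/-- The indicator of a proposition, as a real number. -/
def ind (P : Prop) : ℝ := if P then 1 else 0

lemma ind_nonneg (P : Prop) : 0 ≤ ind P := by
  unfold ind; split_ifs <;> norm_num

lemma ind_le_one (P : Prop) : ind P ≤ 1 := by
  unfold ind; split_ifs <;> norm_num

lemma ind_of {P : Prop} (h : P) : ind P = 1 := if_pos h

lemma ind_of_not {P : Prop} (h : ¬ P) : ind P = 0 := if_neg h

lemma ind_mono {P Q : Prop} (h : P → Q) : ind P ≤ ind Q := by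
  by_cases hP : P
  · rw [ind_of hP, ind_of (h hP)]
  · rw [ind_of_not hP]; exact ind_nonneg Q

lemma ind_or_le (P Q : Prop) : ind (P ∨ Q) ≤ ind P + ind Q := by
  by_cases hP : P
  · rw [ind_of hP]; linarith [ind_le_one (P ∨ Q), ind_nonneg Q]
  · by_cases hQ : Q
    · rw [ind_of hQ]; linarith [ind_le_one (P ∨ Q), ind_nonneg P]
    · rw [ind_of_not (by tauto)]; linarith [ind_nonneg P, ind_nonneg Q]

lemma ind_exists_le {κ : Type*} (s : Finset κ) (P : κ → Prop) :
    ind (∃ k ∈ s, P k) ≤ ∑ k ∈ s, ind (P k) := by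
  by_cases h : ∃ k ∈ s, P k
  · obtain ⟨k, hk, hP⟩ := h
    calc ind (∃ k ∈ s, P k) ≤ 1 := ind_le_one _
      _ = ind (P k) := (ind_of hP).symm
      _ ≤ _ := Finset.single_le_sum (f := fun k => ind (P k)) (fun i _ => ind_nonneg _) hk
  · rw [ind_of_not h]; exact Finset.sum_nonneg fun i _ => ind_nonneg _

open Classical in
lemma sum_ind {κ : Type*} (s : Finset κ) (P : κ → Prop) :
    ∑ k ∈ s, ind (P k) = ((s.filter P).card : ℝ) := by
  simp [ind]

lemma sum_ind_le {κ : Type*} {s : Finset κ} {P : κ → Prop} {K : ℝ}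
    (h : ∀ X ⊆ s, (∀ k ∈ X, P k) → (X.card : ℝ) ≤ K) : ∑ k ∈ s, ind (P k) ≤ K := by
  classical
  rw [sum_ind]
  exact h _ (Finset.filter_subset _ _) fun k hk => (Finset.mem_filter.1 hk).2

section Averages

variable {ι : Type*} [Fintype ι] [DecidableEq ι]

/-- The integer points of the box with half side lengths `N i`. -/
def cube (N : ι → ℕ) : Finset (ι → ℤ) := Fintype.piFinset fun i => symmIcc (N i)

lemma mem_cube {N : ι → ℕ} {x : ι → ℤ} : x ∈ cube N ↔ ∀ i, |x i| ≤ N i := by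
  simp only [cube, Fintype.mem_piFinset, mem_symmIcc]

lemma card_cube_pos (N : ι → ℕ) : (0 : ℝ) < (cube N).card := by
  have : (0 : ι → ℤ) ∈ cube N := mem_cube.2 fun i => by simp
  exact_mod_cast Finset.card_pos.2 ⟨_, this⟩

lemma card_cube (N : ι → ℕ) : ((cube N).card : ℝ) = ∏ i, (2 * (N i : ℝ) + 1) := by
  rw [cube, Fintype.card_piFinset]
  push_cast
  exact Finset.prod_congr rfl fun i _ => card_symmIcc _

lemma update_mem_cube {N : ι → ℕ} {x : ι → ℤ} (hx : x ∈ cube N) {i : ι} {v : ℤ}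
    (hv : v ∈ symmIcc (N i)) : Function.update x i v ∈ cube N := by
  rw [mem_cube] at *
  intro j
  rcases eq_or_ne j i with rfl | h
  · simpa using mem_symmIcc.1 hv
  · simpa [h] using hx j

/-- The average of `g` over the integer points of a box. -/
def avg (N : ι → ℕ) (g : (ι → ℤ) → ℝ) : ℝ := (∑ x ∈ cube N, g x) / (cube N).card

/-- The proportion of the integer points of a box which satisfy `P`. -/
def dens (N : ι → ℕ) (P : (ι → ℤ) → Prop) : ℝ := avg N fun x => ind (P x)

lemma avg_mono {N : ι → ℕ} {g h : (ι → ℤ) → ℝ} (H : ∀ x ∈ cube N, g x ≤ h x) :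
    avg N g ≤ avg N h :=
  div_le_div_of_nonneg_right (Finset.sum_le_sum H) (card_cube_pos N).le

lemma avg_add (N : ι → ℕ) (g h : (ι → ℤ) → ℝ) :
    avg N (fun x => g x + h x) = avg N g + avg N h := by
  simp only [avg, Finset.sum_add_distrib, add_div]

lemma avg_sum (N : ι → ℕ) {κ : Type*} (s : Finset κ) (g : κ → (ι → ℤ) → ℝ) :
    avg N (fun x => ∑ k ∈ s, g k x) = ∑ k ∈ s, avg N (g k) := by
  simp only [avg]
  rw [Finset.sum_comm, Finset.sum_div]

lemma avg_const (N : ι → ℕ) (c : ℝ) : avg N (fun _ => c) = c := by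
  have := card_cube_pos N
  simp only [avg, Finset.sum_const, nsmul_eq_mul]
  field_simp

lemma avg_const_mul (N : ι → ℕ) (c : ℝ) (g : (ι → ℤ) → ℝ) :
    avg N (fun x => c * g x) = c * avg N g := by
  simp only [avg, ← Finset.mul_sum, mul_div_assoc]

open Classical in
lemma dens_eq (N : ι → ℕ) (P : (ι → ℤ) → Prop) :
    dens N P = (((cube N).filter P).card : ℝ) / (cube N).card := by
  rw [dens, avg, sum_ind]

lemma dens_mono {N : ι → ℕ} {P Q : (ι → ℤ) → Prop} (H : ∀ x ∈ cube N, P x → Q x) :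
    dens N P ≤ dens N Q :=
  avg_mono fun x hx => ind_mono (H x hx)

lemma dens_or_le (N : ι → ℕ) (P Q : (ι → ℤ) → Prop) :
    dens N (fun x => P x ∨ Q x) ≤ dens N P + dens N Q := by
  rw [dens, dens, dens, ← avg_add]
  exact avg_mono fun x _ => ind_or_le _ _

lemma dens_exists_le (N : ι → ℕ) {κ : Type*} (s : Finset κ) (P : κ → (ι → ℤ) → Prop) :
    dens N (fun x => ∃ k ∈ s, P k x) ≤ ∑ k ∈ s, dens N (P k) := by
  simp only [dens]
  rw [← avg_sum]
  exact avg_mono fun x _ => ind_exists_le s fun k => P k x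

lemma sum_cube_fiber (N : ι → ℕ) (i : ι) (g : (ι → ℤ) → ℝ) :
    ∑ x ∈ cube N, ∑ v ∈ symmIcc (N i), g (Function.update x i v) =
      (2 * N i + 1) * ∑ x ∈ cube N, g x := by
  have h : ∑ x ∈ cube N, ∑ v ∈ symmIcc (N i), g (Function.update x i v) =
      ∑ x ∈ cube N, ∑ v ∈ symmIcc (N i), g x := by
    rw [← Finset.sum_product', ← Finset.sum_product']
    refine Finset.sum_nbij' (fun q => (Function.update q.1 i q.2, q.1 i))
      (fun q => (Function.update q.1 i q.2, q.1 i)) ?_ ?_ ?_ ?_ ?_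
    · rintro ⟨x, v⟩ h
      rw [Finset.mem_product] at h ⊢
      exact ⟨update_mem_cube h.1 h.2, mem_symmIcc.2 (mem_cube.1 h.1 i)⟩
    · rintro ⟨x, v⟩ h
      rw [Finset.mem_product] at h ⊢
      exact ⟨update_mem_cube h.1 h.2, mem_symmIcc.2 (mem_cube.1 h.1 i)⟩
    · rintro ⟨x, v⟩ _; simp
    · rintro ⟨x, v⟩ _; simp
    · rintro ⟨x, v⟩ _; simp
  rw [h, Finset.mul_sum]
  refine Finset.sum_congr rfl fun x _ => ?_
  rw [Finset.sum_const, nsmul_eq_mul, card_symmIcc]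

lemma avg_le_avg_of_fiber {N : ι → ℕ} (i : ι) {g h : (ι → ℤ) → ℝ}
    (H : ∀ x ∈ cube N, ∑ v ∈ symmIcc (N i), g (Function.update x i v) ≤ (2 * N i + 1) * h x) :
    avg N g ≤ avg N h := by
  have h1 := Finset.sum_le_sum H
  rw [sum_cube_fiber, ← Finset.mul_sum] at h1
  refine div_le_div_of_nonneg_right ?_ (card_cube_pos N).le
  exact le_of_mul_le_mul_left h1 (by positivity)

lemma dens_le_of_fiber {N : ι → ℕ} (i : ι) {P : (ι → ℤ) → Prop} {K : ℝ}
    (H : ∀ x ∈ cube N, ∀ X ⊆ symmIcc (N i), (∀ v ∈ X, P (Function.update x i v)) →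
      (X.card : ℝ) ≤ (2 * N i + 1) * K) : dens N P ≤ K := by
  rw [← avg_const N K]
  exact avg_le_avg_of_fiber i fun x hx => sum_ind_le (H x hx)

end Averages

lemma card_le_of_pairwise_dvd {X : Finset ℤ} {N m : ℕ} (hm : 0 < m) (hX : X ⊆ symmIcc N)
    (h : ∀ x ∈ X, ∀ y ∈ X, (m : ℤ) ∣ x - y) : (X.card : ℝ) ≤ (2 * N + 1) / m + 1 := by
  rcases X.eq_empty_or_nonempty with rfl | ⟨y, hy⟩
  · simp only [Finset.card_empty, Nat.cast_zero]; positivity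
  have hsub : X ⊆ (Finset.Ioc (-(N : ℤ) - 1) N).filter fun x => x ≡ y [ZMOD (m : ℤ)] := by
    intro x hx
    have := hX hx
    rw [symmIcc, Finset.mem_Icc] at this
    rw [Finset.mem_filter, Finset.mem_Ioc]
    exact ⟨⟨by omega, by omega⟩, Int.modEq_iff_dvd.2 (h y hy x hx)⟩
  have hcard := Int.Ioc_filter_modEq_card (-(N : ℤ) - 1) N (r := m) (by exact_mod_cast hm) y
  have h1 : (X.card : ℤ) ≤ _ := (Int.ofNat_le.2 (Finset.card_le_card hsub)).trans_eq hcard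
  have e3 : ((N : ℚ) - y) / m - (-(N : ℚ) - 1 - y) / m = (2 * N + 1) / m := by ring
  have h2 : (X.card : ℚ) ≤ (2 * N + 1) / m + 1 := by
    rcases le_max_iff.1 h1 with h1 | h1
    · have h2 := (Int.cast_le (R := ℚ)).2 h1
      push_cast at h2
      have e1 := Int.floor_le (((N : ℚ) - y) / m)
      have e2 := Int.lt_floor_add_one ((-(N : ℚ) - 1 - y) / m)
      linarith
    · have h2 := (Int.cast_le (R := ℚ)).2 h1
      push_cast at h2
      have : (0 : ℚ) ≤ (2 * N + 1) / m := by positivity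
      linarith
  have h4 := (Rat.cast_le (K := ℝ)).2 h2
  push_cast at h4
  exact h4

lemma card_ne_zero_dvd_le {N p : ℕ} (hp : 0 < p) {X : Finset ℤ} (hX : X ⊆ symmIcc N)
    (h : ∀ v ∈ X, v ≠ 0 ∧ (p : ℤ) ∣ v) : (X.card : ℝ) ≤ (2 * N + 1) / p := by
  have h0 : (0 : ℤ) ∉ X := fun h0 => (h 0 h0).1 rfl
  have hdvd : ∀ v ∈ insert 0 X, (p : ℤ) ∣ v := fun v hv => by
    rcases Finset.mem_insert.1 hv with rfl | hv
    exacts [dvd_zero _, (h v hv).2]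
  have h2 := card_le_of_pairwise_dvd (X := insert 0 X) hp
    (Finset.insert_subset (by simp [mem_symmIcc]) hX)
    fun x hx y hy => dvd_sub (hdvd x hx) (hdvd y hy)
  rw [Finset.card_insert_of_notMem h0] at h2
  push_cast at h2
  linarith

open Classical in
lemma tendsto_residue_proportion {m : ℕ} [NeZero m] (r : ZMod m) :
    Tendsto (fun N : ℕ => (((symmIcc N).filter fun v : ℤ => (v : ZMod m) = r).card : ℝ) / (2 * N + 1))
      atTop (nhds (1 / m)) := by
  have hm : 0 < m := Nat.pos_of_neZero m
  have upper (N : ℕ) (r : ZMod m) :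
      (((symmIcc N).filter fun v : ℤ => (v : ZMod m) = r).card : ℝ) ≤ (2 * N + 1) / m + 1 := by
    refine card_le_of_pairwise_dvd hm (Finset.filter_subset _ _) fun x hx y hy => ?_
    rw [← ZMod.intCast_zmod_eq_zero_iff_dvd, Int.cast_sub, (Finset.mem_filter.1 hx).2,
      (Finset.mem_filter.1 hy).2, sub_self]
  have lower (N : ℕ) : (2 * (N : ℝ) + 1) / m - m ≤
      (((symmIcc N).filter fun v : ℤ => (v : ZMod m) = r).card : ℝ) := by
    have h1 : ((symmIcc N).card : ℝ) =
        ∑ q : ZMod m, (((symmIcc N).filter fun v : ℤ => (v : ZMod m) = q).card : ℝ) := by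
      have h0 := Finset.card_eq_sum_card_fiberwise (f := fun v : ℤ => (v : ZMod m))
        (s := symmIcc N) (t := Finset.univ) (fun _ _ => Finset.mem_coe.2 (Finset.mem_univ _))
      rw [h0, Nat.cast_sum]
    rw [card_symmIcc, ← Finset.add_sum_erase _ _ (Finset.mem_univ r)] at h1
    have h2 := Finset.sum_le_card_nsmul ((Finset.univ : Finset (ZMod m)).erase r)
      (fun q => (((symmIcc N).filter fun v : ℤ => (v : ZMod m) = q).card : ℝ)) _ fun q _ => upper N q
    rw [Finset.card_erase_of_mem (Finset.mem_univ r), Finset.card_univ, ZMod.card, nsmul_eq_mul,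
      Nat.cast_sub hm, Nat.cast_one] at h2
    have hm' : (0 : ℝ) < m := by exact_mod_cast hm
    have h3 : ((m : ℝ) - 1) * ((2 * N + 1) / m + 1) = 2 * N + 1 - (2 * N + 1) / m + m - 1 := by
      field_simp; ring
    linarith
  have hz : Tendsto (fun N : ℕ => 1 / (2 * (N : ℝ) + 1)) atTop (nhds 0) := by
    refine tendsto_const_nhds.div_atTop ?_
    exact tendsto_atTop_add_const_right _ _
      (tendsto_natCast_atTop_atTop.const_mul_atTop (by norm_num))
  have h1 : Tendsto (fun N : ℕ => 1 / (m : ℝ) - m * (1 / (2 * (N : ℝ) + 1))) atTop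
      (nhds (1 / m)) := by
    simpa using tendsto_const_nhds.sub (hz.const_mul (m : ℝ))
  have h2 : Tendsto (fun N : ℕ => 1 / (m : ℝ) + 1 / (2 * (N : ℝ) + 1)) atTop
      (nhds (1 / m)) := by
    simpa using tendsto_const_nhds.add hz
  refine tendsto_of_tendsto_of_tendsto_of_le_of_le h1 h2 (fun N => ?_) fun N => ?_
  · have hp : (0 : ℝ) < 2 * N + 1 := by positivity
    rw [le_div_iff₀ hp]
    refine le_of_eq_of_le ?_ (lower N)
    field_simp
  · have hp : (0 : ℝ) < 2 * N + 1 := by positivity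
    rw [div_le_iff₀ hp]
    refine (upper N r).trans_eq ?_
    field_simp

section Residues

variable {ι : Type*} [Fintype ι] [DecidableEq ι]

/-- The reduction of an integer vector modulo `m`. -/
def redMod (m : ℕ) (x : ι → ℤ) : ι → ZMod m := fun i => (x i : ZMod m)

lemma tendsto_dens_redMod_eq {m : ℕ} [NeZero m] (r : ι → ZMod m) :
    Tendsto (fun N : ι → ℕ => dens N fun x => redMod m x = r) atTop
      (nhds (1 / (m : ℝ) ^ Fintype.card ι)) := by
  classical
  have h (N : ι → ℕ) : dens N (fun x => redMod m x = r) = ∏ i,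
      ((((symmIcc (N i)).filter fun v : ℤ => (v : ZMod m) = r i).card : ℝ) / (2 * N i + 1)) := by
    rw [dens_eq, Finset.prod_div_distrib, card_cube]
    congr 1
    have : (cube N).filter (fun x => redMod m x = r) =
        Fintype.piFinset fun i => (symmIcc (N i)).filter fun v : ℤ => (v : ZMod m) = r i := by
      ext x
      simp only [cube, Finset.mem_filter, Fintype.mem_piFinset, funext_iff, redMod, forall_and]
    have key : (((cube N).filter fun x => redMod m x = r).card : ℝ) = ∏ i,
        (((symmIcc (N i)).filter fun v : ℤ => (v : ZMod m) = r i).card : ℝ) := by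
      rw [this, Fintype.card_piFinset, Nat.cast_prod]
    convert key
  have heval (i : ι) : Tendsto (fun N : ι → ℕ => N i) atTop atTop :=
    tendsto_atTop.2 fun b => by
      filter_upwards [eventually_ge_atTop (fun _ => b)] with N hN using hN i
  simp only [h]
  have := tendsto_finsetProd (Finset.univ : Finset ι) (f := fun i (N : ι → ℕ) =>
    ((((symmIcc (N i)).filter fun v : ℤ => (v : ZMod m) = r i).card : ℝ) / (2 * N i + 1)))
    (a := fun _ => 1 / (m : ℝ)) (x := atTop) fun i _ =>
      (tendsto_residue_proportion (r i)).comp (heval i)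
  simpa using this

lemma tendsto_dens_redMod_mem {m : ℕ} [NeZero m] (A : Set (ι → ZMod m)) :
    Tendsto (fun N : ι → ℕ => dens N fun x => redMod m x ∈ A) atTop
      (nhds ((Nat.card A : ℝ) / (m : ℝ) ^ Fintype.card ι)) := by
  classical
  have h (N : ι → ℕ) : dens N (fun x => redMod m x ∈ A) =
      ∑ r ∈ A.toFinset, dens N fun x => redMod m x = r := by
    simp only [dens]
    rw [← avg_sum]
    congr 1
    ext x
    by_cases hx : redMod m x ∈ A
    · rw [ind_of hx, Finset.sum_eq_single_of_mem (redMod m x) (by simpa using hx)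
        fun r _ hr => ind_of_not hr.symm, ind_of rfl]
    · rw [ind_of_not hx, Finset.sum_eq_zero]
      rintro r hr
      refine ind_of_not ?_
      rintro rfl
      exact hx (by simpa using hr)
  simp only [h]
  have := tendsto_finsetSum A.toFinset fun r _ => tendsto_dens_redMod_eq (m := m) r
  refine this.trans (le_of_eq ?_)
  rw [Finset.sum_const, nsmul_eq_mul, Set.toFinset_card, Nat.card_eq_fintype_card]
  ring_nf

lemma tendsto_dens_forall_redMod_mem {κ : Type*} [Fintype κ] (a : κ → ℕ) (ha : ∀ k, a k ≠ 0)
    (hc : Pairwise (Function.onFun Nat.Coprime a)) (A : ∀ k, Set (ι → ZMod (a k))) :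
    Tendsto (fun N : ι → ℕ => dens N fun x => ∀ k, redMod (a k) x ∈ A k) atTop
      (nhds (∏ k, ((Nat.card (A k) : ℝ) / (a k : ℝ) ^ Fintype.card ι))) := by
  classical
  have : NeZero (∏ k, a k) := ⟨Finset.prod_ne_zero_iff.2 fun k _ => ha k⟩
  let e := ZMod.prodEquivPi a hc
  let E : (ι → ZMod (∏ k, a k)) ≃ (∀ k, ι → ZMod (a k)) :=
    (Equiv.arrowCongr (Equiv.refl ι) e.toEquiv).trans (Equiv.piComm _)
  have hE (x : ι → ℤ) (k : κ) : E (redMod _ x) k = redMod (a k) x := by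
    ext i
    change e (redMod _ x i) k = _
    simp [redMod]
  let B : Set (ι → ZMod (∏ k, a k)) := {y | ∀ k, E y k ∈ A k}
  have h1 := tendsto_dens_redMod_mem B
  have h2 : Nat.card B = ∏ k, Nat.card (A k) := by
    rw [← Nat.card_pi]
    refine Nat.card_congr ((E.subtypeEquiv (q := fun y => ∀ k, y k ∈ A k) fun y => Iff.rfl).trans ?_)
    exact Equiv.subtypePiEquivPi
  rw [h2] at h1
  have h3 : ((∏ k, Nat.card (A k) : ℕ) : ℝ) / ((∏ k, a k : ℕ) : ℝ) ^ Fintype.card ι =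
      ∏ k, ((Nat.card (A k) : ℝ) / (a k : ℝ) ^ Fintype.card ι) := by
    push_cast
    rw [Finset.prod_div_distrib, Finset.prod_pow]
  rw [h3] at h1
  refine h1.congr fun N => ?_
  congr 1
  ext x
  simp only [B, Set.mem_ofPred_eq, hE]

end Residues

lemma eventually_primeCounting_mul_le (c : ℕ) {δ : ℝ} (hδ : 0 < δ) :
    ∀ᶠ T : ℕ in atTop, ((c * T).primeCounting : ℝ) ≤ δ * T := by
  rcases Nat.eq_zero_or_pos c with rfl | hc
  · filter_upwards with T
    simp only [zero_mul, Nat.primeCounting_zero, Nat.cast_zero]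
    positivity
  have hc' : (0 : ℝ) < c := by exact_mod_cast hc
  have hlim : Tendsto (fun T : ℕ => (c : ℝ) * (T : ℝ)) atTop atTop :=
    tendsto_natCast_atTop_atTop.const_mul_atTop hc'
  have h4 : 0 < Real.log 4 := Real.log_pos (by norm_num)
  filter_upwards [hlim.eventually (Chebyshev.eventually_primeCounting_le one_pos),
    (Real.tendsto_log_atTop.comp hlim).eventually_ge_atTop ((Real.log 4 + 1) * c / δ)] with T h1 h2
  have h3 : ⌊(c : ℝ) * (T : ℝ)⌋₊ = c * T := by
    rw [← Nat.cast_mul, Nat.floor_natCast]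
  rw [h3] at h1
  refine h1.trans ?_
  have hK : 0 < (Real.log 4 + 1) * c / δ := by positivity
  have hlog : 0 < Real.log ((c : ℝ) * T) := hK.trans_le h2
  rw [div_le_iff₀ hlog]
  have h5 : (Real.log 4 + 1) * c ≤ δ * Real.log ((c : ℝ) * T) := by
    have := (div_le_iff₀ hδ).1 h2
    simp only [Function.comp] at this
    linarith
  have hT : (0 : ℝ) ≤ T := Nat.cast_nonneg T
  nlinarith [mul_le_mul_of_nonneg_right h5 hT]

open Classical in
lemma card_le_of_two_classes {X : Finset ℤ} {N m : ℕ} (hm : 0 < m) (hX : X ⊆ symmIcc N)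
    {R S : ℤ → Prop} (hRS : ∀ x ∈ X, R x ∨ S x)
    (hR : ∀ x ∈ X, ∀ y ∈ X, R x → R y → (m : ℤ) ∣ x - y)
    (hS : ∀ x ∈ X, ∀ y ∈ X, S x → S y → (m : ℤ) ∣ x - y) :
    (X.card : ℝ) ≤ 2 * ((2 * N + 1) / m + 1) := by
  have h1 : (X.card : ℝ) ≤ (X.filter R).card + (X.filter S).card := by
    have : X ⊆ X.filter R ∪ X.filter S := fun x hx => by
      have := hRS x hx
      simp only [Finset.mem_union, Finset.mem_filter]; tauto
    exact_mod_cast (Finset.card_le_card this).trans (Finset.card_union_le _ _)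
  have h2 := card_le_of_pairwise_dvd (X := X.filter R) hm ((Finset.filter_subset _ _).trans hX)
    fun x hx y hy => by
      rw [Finset.mem_filter] at hx hy
      exact hR x hx.1 y hy.1 hx.2 hy.2
  have h3 := card_le_of_pairwise_dvd (X := X.filter S) hm ((Finset.filter_subset _ _).trans hX)
    fun x hx y hy => by
      rw [Finset.mem_filter] at hx hy
      exact hS x hx.1 y hy.1 hx.2 hy.2
  linarith

lemma sum_Ioc_inv_sq_le_inv {M : ℕ} (hM : M ≠ 0) (n : ℕ) :
    ∑ i ∈ Finset.Ioc M n, 1 / (i : ℝ) ^ 2 ≤ 1 / (M : ℝ) := by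
  simp only [one_div]
  rcases le_total M n with h | h
  · have := sum_Ioc_inv_sq_le_sub (α := ℝ) hM h
    have h2 : (0 : ℝ) ≤ (n : ℝ)⁻¹ := by positivity
    linarith
  · rw [Finset.Ioc_eq_empty (by omega), Finset.sum_empty]; positivity

section QuadraticSieve

variable {A B C : ℤ}

lemma card_quadratic_zeros_le (hA : A ≠ 0) {T : ℕ} {X : Finset ℤ} (hX : X ⊆ symmIcc T)
    (h0 : ∀ v ∈ X, A * v ^ 2 + B * v + C = 0) : (X.card : ℝ) ≤ 4 := by
  rcases X.eq_empty_or_nonempty with rfl | ⟨x₀, hx₀⟩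
  · simp
  have h := card_le_of_two_classes (X := X) (m := 2 * T + 1) (by omega) hX (R := fun x => x = x₀)
    (S := fun x => A * (x + x₀) + B = 0) (fun x hx => ?_) (fun x _ y _ hx hy => ?_)
    fun x _ y _ hx hy => ?_
  · have : (0 : ℝ) < 2 * T + 1 := by positivity
    push_cast at h
    rw [div_self this.ne'] at h
    linarith
  · have : (x - x₀) * (A * (x + x₀) + B) = 0 := by linear_combination h0 x hx - h0 x₀ hx₀
    rcases mul_eq_zero.1 this with h | h
    · left; linarith
    · right; exact h
  · simp [hx, hy]
  · have : A * (x - y) = 0 := by linear_combination hx - hy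
    rw [(mul_eq_zero.1 this).resolve_left hA]
    exact dvd_zero _

lemma card_quadratic_dvd_le {p : ℕ} (hp : p.Prime) (hpA : ¬ (p : ℤ) ∣ A * (B ^ 2 - 4 * A * C))
    {T : ℕ} {X : Finset ℤ} (hX : X ⊆ symmIcc T)
    (h0 : ∀ v ∈ X, (p : ℤ) ^ 2 ∣ A * v ^ 2 + B * v + C) :
    (X.card : ℝ) ≤ 2 * ((2 * T + 1) / (p : ℝ) ^ 2 + 1) := by
  rcases X.eq_empty_or_nonempty with rfl | ⟨x₀, hx₀⟩
  · simp only [Finset.card_empty, Nat.cast_zero]; positivity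
  have hpi : Prime (p : ℤ) := Nat.prime_iff_prime_int.1 hp
  have hA : ¬ (p : ℤ) ∣ A := fun h => hpA (h.mul_right _)
  have hD : ¬ (p : ℤ) ∣ B ^ 2 - 4 * A * C := fun h => hpA (h.mul_left _)
  have hcop : IsCoprime ((p : ℤ) ^ 2) A :=
    ((Prime.coprime_iff_not_dvd hpi).2 hA).pow_left
  have h := card_le_of_two_classes (X := X) (m := p ^ 2) (pow_pos hp.pos 2) hX
    (R := fun x => (p : ℤ) ^ 2 ∣ x - x₀) (S := fun x => (p : ℤ) ^ 2 ∣ A * (x + x₀) + B)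
    (fun x hx => ?_) (fun x _ y _ hx hy => ?_) fun x _ y _ hx hy => ?_
  · exact_mod_cast h
  · have hprod : (p : ℤ) ^ 2 ∣ (x - x₀) * (A * (x + x₀) + B) := by
      have := dvd_sub (h0 x hx) (h0 x₀ hx₀)
      exact this.trans (dvd_of_eq (by ring))
    by_cases h1 : (p : ℤ) ∣ x - x₀
    · by_cases h2 : (p : ℤ) ∣ A * (x + x₀) + B
      · exfalso
        apply hD
        have h3 : (p : ℤ) ∣ 2 * A * x₀ + B := by
          have := dvd_sub h2 (h1.mul_left A)
          exact this.trans (dvd_of_eq (by ring))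
        have h4 : (p : ℤ) ∣ A * x₀ ^ 2 + B * x₀ + C := (Dvd.intro_left _ (sq (p : ℤ)).symm).trans
          (h0 x₀ hx₀)
        have := dvd_sub (h3.mul_right (2 * A * x₀ + B)) (h4.mul_left (4 * A))
        exact this.trans (dvd_of_eq (by ring))
      · left
        exact (((Prime.coprime_iff_not_dvd hpi).2 h2).pow_left).dvd_of_dvd_mul_right hprod
    · right
      exact (((Prime.coprime_iff_not_dvd hpi).2 h1).pow_left).dvd_of_dvd_mul_left hprod
  · have := dvd_sub hx hy
    push_cast
    exact this.trans (dvd_of_eq (by ring))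
  · push_cast
    refine hcop.dvd_of_dvd_mul_left ?_
    have := dvd_sub hx hy
    exact this.trans (dvd_of_eq (by ring))

open Classical in
lemma eventually_card_quadratic_le (hA : A ≠ 0) (hD : B ^ 2 - 4 * A * C ≠ 0) {M : ℕ} (hM : M ≠ 0)
    (hbad : ∀ p : ℕ, p.Prime → M < p → (p : ℤ) ∣ A * (B ^ 2 - 4 * A * C) → ∀ v w : ℤ,
      (p : ℤ) ^ 2 ∣ A * v ^ 2 + B * v + C → (p : ℤ) ^ 2 ∣ A * w ^ 2 + B * w + C → (p : ℤ) ∣ v - w)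
    {δ : ℝ} (hδ : 0 < δ) :
    ∀ᶠ T : ℕ in atTop, (((symmIcc T).filter fun v : ℤ => A * v ^ 2 + B * v + C = 0 ∨
        ∃ p : ℕ, p.Prime ∧ M < p ∧ (p : ℤ) ^ 2 ∣ A * v ^ 2 + B * v + C).card : ℝ) ≤
      (2 * T + 1) * (2 / M + ∑ p ∈ (A * (B ^ 2 - 4 * A * C)).natAbs.primeFactors with M < p,
        1 / (p : ℝ) + δ) := by
  set F : Finset ℕ := (A * (B ^ 2 - 4 * A * C)).natAbs.primeFactors.filter (M < ·) with hF
  set c : ℕ := A.natAbs + B.natAbs + C.natAbs with hc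
  have hAD : A * (B ^ 2 - 4 * A * C) ≠ 0 := mul_ne_zero hA hD
  have hlarge : ∀ᶠ T : ℕ in atTop, (4 + F.card : ℝ) ≤ δ / 2 * T :=
    (tendsto_natCast_atTop_atTop.const_mul_atTop (half_pos hδ)).eventually_ge_atTop _
  filter_upwards [eventually_primeCounting_mul_le c (δ := δ / 4) (by positivity), hlarge,
    eventually_ge_atTop 1] with T hT1 hT2 hT3
  set f : ℤ → ℤ := fun v => A * v ^ 2 + B * v + C with hf
  have hfle (v : ℤ) (hv : v ∈ symmIcc T) : |f v| ≤ c * T ^ 2 := by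
    rw [mem_symmIcc] at hv
    have hT : (1 : ℤ) ≤ T := by exact_mod_cast hT3
    have h2 : |v| ^ 2 ≤ (T : ℤ) ^ 2 := pow_le_pow_left₀ (abs_nonneg v) hv 2
    have h1 : |v| ≤ (T : ℤ) ^ 2 := by nlinarith
    have h0 : (1 : ℤ) ≤ (T : ℤ) ^ 2 := by nlinarith
    calc |f v| ≤ |A * v ^ 2| + |B * v| + |C| := abs_add_three _ _ _
      _ = |A| * |v| ^ 2 + |B| * |v| + |C| * 1 := by rw [abs_mul, abs_mul, abs_pow, mul_one]
      _ ≤ |A| * T ^ 2 + |B| * T ^ 2 + |C| * T ^ 2 := by gcongr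
      _ = c * T ^ 2 := by
        rw [hc]; push_cast; ring
  let P : Finset ℕ := (Nat.primesLE (c * T)).filter fun p =>
    M < p ∧ ¬ (p : ℤ) ∣ A * (B ^ 2 - 4 * A * C)
  let Y : ℕ → Finset ℤ := fun p => (symmIcc T).filter fun v => (p : ℤ) ^ 2 ∣ f v
  have hsub : ((symmIcc T).filter fun v : ℤ => f v = 0 ∨
        ∃ p : ℕ, p.Prime ∧ M < p ∧ (p : ℤ) ^ 2 ∣ f v) ⊆
      ((symmIcc T).filter fun v => f v = 0) ∪ (F.biUnion Y ∪ P.biUnion Y) := by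
    intro v hv
    rw [Finset.mem_filter] at hv
    obtain ⟨hvT, hv⟩ := hv
    rw [Finset.mem_union, Finset.mem_union, Finset.mem_filter]
    by_cases h0 : f v = 0
    · exact Or.inl ⟨hvT, h0⟩
    obtain ⟨p, hp, hMp, hpv⟩ := hv.resolve_left h0
    have hYp : v ∈ Y p := Finset.mem_filter.2 ⟨hvT, hpv⟩
    right
    by_cases hpAD : (p : ℤ) ∣ A * (B ^ 2 - 4 * A * C)
    · left
      refine Finset.mem_biUnion.2 ⟨p, ?_, hYp⟩
      rw [hF, Finset.mem_filter, Nat.mem_primeFactors]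
      exact ⟨⟨hp, Int.natCast_dvd.1 hpAD, Int.natAbs_ne_zero.2 hAD⟩, hMp⟩
    · right
      refine Finset.mem_biUnion.2 ⟨p, ?_, hYp⟩
      rw [Finset.mem_filter, Nat.mem_primesLE]
      refine ⟨⟨?_, hp⟩, hMp, hpAD⟩
      have h1 : (p : ℤ) ^ 2 ≤ |f v| := Int.le_of_dvd (abs_pos.2 h0) ((dvd_abs _ _).2 hpv)
      have h2 : (p : ℤ) ^ 2 ≤ ((c * T : ℕ) : ℤ) ^ 2 := by
        refine (h1.trans (hfle v hvT)).trans ?_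
        push_cast
        rw [mul_pow]
        have : (c : ℤ) ≤ (c : ℤ) ^ 2 := by exact_mod_cast Nat.le_self_pow two_ne_zero c
        gcongr
      have h3 : p ^ 2 ≤ (c * T) ^ 2 := by exact_mod_cast h2
      exact (Nat.pow_le_pow_iff_left two_ne_zero).1 h3
  have hcard := (Finset.card_le_card hsub).trans ((Finset.card_union_le _ _).trans
    (Nat.add_le_add_left ((Finset.card_union_le _ _).trans
      (Nat.add_le_add Finset.card_biUnion_le Finset.card_biUnion_le)) _))
  have hcard' := (Nat.cast_le (α := ℝ)).2 hcard
  push_cast at hcard'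
  refine hcard'.trans ?_
  have hz := card_quadratic_zeros_le (B := B) (C := C) hA (Finset.filter_subset (fun v => f v = 0)
    (symmIcc T)) fun v hv => (Finset.mem_filter.1 hv).2
  have hFsum : ∑ p ∈ F, ((Y p).card : ℝ) ≤ (2 * T + 1) * ∑ p ∈ F, 1 / (p : ℝ) + F.card := by
    have : ∀ p ∈ F, ((Y p).card : ℝ) ≤ (2 * T + 1) * (1 / (p : ℝ)) + 1 := fun p hp => by
      rw [hF, Finset.mem_filter, Nat.mem_primeFactors] at hp
      have := card_le_of_pairwise_dvd (X := Y p) hp.1.1.pos (Finset.filter_subset _ _)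
        fun x hx y hy => hbad p hp.1.1 hp.2 (Int.natCast_dvd.2 hp.1.2.1) x y
          (Finset.mem_filter.1 hx).2 (Finset.mem_filter.1 hy).2
      rwa [mul_one_div]
    refine (Finset.sum_le_sum this).trans_eq ?_
    rw [Finset.sum_add_distrib, ← Finset.mul_sum]
    simp
  have hPsum : ∑ p ∈ P, ((Y p).card : ℝ) ≤ (2 * T + 1) * (2 / M) + 2 * (c * T).primeCounting := by
    have h1 : ∀ p ∈ P, ((Y p).card : ℝ) ≤ 2 * (2 * T + 1) * (1 / (p : ℝ) ^ 2) + 2 := fun p hp => by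
      rw [Finset.mem_filter, Nat.mem_primesLE] at hp
      refine (card_quadratic_dvd_le hp.1.2 hp.2.2 (Finset.filter_subset _ _)
        fun v hv => (Finset.mem_filter.1 hv).2).trans_eq ?_
      ring
    have h2 : P ⊆ Finset.Ioc M (c * T) := fun p hp => by
      rw [Finset.mem_filter, Nat.mem_primesLE] at hp
      exact Finset.mem_Ioc.2 ⟨hp.2.1, hp.1.1⟩
    have h3 : ∑ p ∈ P, 1 / (p : ℝ) ^ 2 ≤ 1 / (M : ℝ) :=
      (Finset.sum_le_sum_of_subset_of_nonneg h2 fun _ _ _ => by positivity).trans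
        (sum_Ioc_inv_sq_le_inv hM _)
    have h4 : (P.card : ℝ) ≤ (c * T).primeCounting := by
      rw [← Nat.primesLE_card_eq_primeCounting]
      exact_mod_cast Finset.card_le_card (Finset.filter_subset _ _)
    refine (Finset.sum_le_sum h1).trans ?_
    rw [Finset.sum_add_distrib, ← Finset.mul_sum, Finset.sum_const, nsmul_eq_mul]
    have h5 : 2 * (2 * (T : ℝ) + 1) * ∑ p ∈ P, 1 / (p : ℝ) ^ 2 ≤ 2 * (2 * T + 1) * (1 / M) := by
      gcongr
    have h6 : 2 * (2 * (T : ℝ) + 1) * (1 / M) = (2 * T + 1) * (2 / M) := by ring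
    linarith
  have hδ' : δ * T ≤ (2 * T + 1) * δ := by nlinarith [(Nat.cast_nonneg T : (0 : ℝ) ≤ T)]
  rw [mul_add, mul_add]
  linarith

end QuadraticSieve

section IteratedFilter

variable {ι : Type*} [DecidableEq ι]

/-- The filter of neighbourhoods of infinity on `ι → ℕ` for which the coordinate `n` tends to
infinity first, and the other coordinates afterwards. -/
def iterAtTop (n : ι) : Filter (ι → ℕ) :=
  (atTop : Filter (ι → ℕ)).bind fun s => (atTop : Filter ℕ).map (Function.update s n)

lemma eventually_iterAtTop {n : ι} {P : (ι → ℕ) → Prop} :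
    (∀ᶠ N in iterAtTop n, P N) ↔
      ∀ᶠ s : ι → ℕ in atTop, ∀ᶠ T : ℕ in atTop, P (Function.update s n T) := by
  rw [iterAtTop, eventually_bind]
  simp only [eventually_map]

lemma iterAtTop_le_atTop (n : ι) : iterAtTop n ≤ atTop := by
  intro S hS
  obtain ⟨N₀, hN₀⟩ := mem_atTop_sets.1 hS
  refine eventually_iterAtTop.2 ?_
  filter_upwards [eventually_ge_atTop N₀] with s hs
  filter_upwards [eventually_ge_atTop (N₀ n)] with T hT
  exact hN₀ _ (le_update_iff.2 ⟨hT, fun j _ => hs j⟩)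

end IteratedFilter

section Tail

variable {ι : Type*} [DecidableEq ι]

/-- No two of the coordinates of `x` other than the `n`-th one are divisible by `p`. -/
def AlmostCoprime (n : ι) (p : ℕ) (x : ι → ℤ) : Prop :=
  ∀ i j, i ≠ n → j ≠ n → i ≠ j → (p : ℤ) ∣ x i → ¬ (p : ℤ) ∣ x j

/-- The coordinates of `x` other than the `n`-th one are nonzero, and no prime exceeding `M`
divides two of them. -/
def Generic (n : ι) (M : ℕ) (x : ι → ℤ) : Prop :=
  (∀ i, i ≠ n → x i ≠ 0) ∧ ∀ p : ℕ, p.Prime → M < p → AlmostCoprime n p x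

lemma generic_update {n : ι} {M : ℕ} {x : ι → ℤ} {v : ℤ} :
    Generic n M (Function.update x n v) ↔ Generic n M x := by
  unfold Generic AlmostCoprime
  constructor <;> rintro ⟨h1, h2⟩
  · refine ⟨fun i hi => ?_, fun p hp hM i j hi hj => ?_⟩
    · simpa [hi] using h1 i hi
    · simpa [hi, hj] using h2 p hp hM i j hi hj
  · refine ⟨fun i hi => ?_, fun p hp hM i j hi hj => ?_⟩
    · simpa [hi] using h1 i hi
    · simpa [hi, hj] using h2 p hp hM i j hi hj

/-- The integer function `R` is quadratic in the `n`-th coordinate, and the primes at which this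
quadratic polynomial degenerates are controlled by the auxiliary functions `q k`. -/
structure QuadraticFiber (R : (ι → ℤ) → ℤ) (n : ι) (κ : Type*) [Fintype κ] where
  (A B C : (ι → ℤ) → ℤ)
  q : κ → (ι → ℤ) → ℤ
  J : κ → Finset ι
  eval : ∀ x t, R (Function.update x n t) = A x * t ^ 2 + B x * t + C x
  disc_dvd : ∀ x, A x * (B x ^ 2 - 4 * A x * C x) ∣ (∏ k, q k x) ^ 2
  J_nonempty : ∀ k, (J k).Nonempty
  q_update : ∀ k x t, q k (Function.update x n t) = q k x
  q_bound : ∀ k x (Z : ℤ), (∀ i ∈ J k, |x i| ≤ Z) → |q k x| ≤ 5 * Z ^ 2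
  q_class : ∀ k, ∀ i ∈ J k, ∀ (x : ι → ℤ) (v w : ℤ) (p : ℕ), p.Prime → 2 < p →
    AlmostCoprime n p (Function.update x i v) → AlmostCoprime n p (Function.update x i w) →
    (p : ℤ) ∣ q k (Function.update x i v) → (p : ℤ) ∣ q k (Function.update x i w) →
    (p : ℤ) ∣ v ^ 2 - w ^ 2
  singular : ∀ (x : ι → ℤ) (v w : ℤ) (p : ℕ), p.Prime → 2 < p → AlmostCoprime n p x →
    (p : ℤ) ∣ A x * (B x ^ 2 - 4 * A x * C x) →
    (p : ℤ) ^ 2 ∣ R (Function.update x n v) → (p : ℤ) ^ 2 ∣ R (Function.update x n w) →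
    (p : ℤ) ∣ v - w

variable [Fintype ι]

lemma dens_eq_zero_le (N : ι → ℕ) (i : ι) : dens N (fun x => x i = 0) ≤ 1 / (2 * N i + 1) := by
  classical
  refine dens_le_of_fiber i fun x _ X _ hX => ?_
  have hp : (0 : ℝ) < 2 * N i + 1 := by positivity
  rw [mul_one_div_cancel hp.ne']
  have : X ⊆ {0} := fun v hv => by simpa using hX v hv
  exact_mod_cast Finset.card_le_card this

lemma dens_dvd_dvd_le (N : ι → ℕ) {i j : ι} (hij : i ≠ j) {p : ℕ} (hp : 0 < p) :
    dens N (fun x => (x i ≠ 0 ∧ (p : ℤ) ∣ x i) ∧ (x j ≠ 0 ∧ (p : ℤ) ∣ x j)) ≤ 1 / (p : ℝ) ^ 2 := by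
  classical
  have hp' : (0 : ℝ) < p := by exact_mod_cast hp
  have key (i : ι) (X : Finset ℤ) (hX : X ⊆ symmIcc (N i)) (h : ∀ v ∈ X, v ≠ 0 ∧ (p : ℤ) ∣ v) :
      (X.card : ℝ) ≤ (2 * N i + 1) * (1 / p) := by
    rw [mul_one_div]; exact card_ne_zero_dvd_le hp hX h
  calc dens N (fun x => (x i ≠ 0 ∧ (p : ℤ) ∣ x i) ∧ (x j ≠ 0 ∧ (p : ℤ) ∣ x j))
      ≤ avg N fun x => 1 / p * ind (x j ≠ 0 ∧ (p : ℤ) ∣ x j) := by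
        refine avg_le_avg_of_fiber i fun x _ => ?_
        by_cases hj : x j ≠ 0 ∧ (p : ℤ) ∣ x j
        · rw [ind_of hj, mul_one]
          refine sum_ind_le fun X hX h => key i X hX fun v hv => ?_
          have := (h v hv).1
          rwa [Function.update_self] at this
        · rw [ind_of_not hj, mul_zero, mul_zero]
          refine (Finset.sum_eq_zero fun v _ => ind_of_not fun h => hj ?_).le
          have := h.2
          rwa [Function.update_of_ne hij.symm] at this
    _ = 1 / p * dens N (fun x => x j ≠ 0 ∧ (p : ℤ) ∣ x j) := avg_const_mul _ _ _
    _ ≤ 1 / p * (1 / p) := by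
        gcongr
        refine dens_le_of_fiber j fun x _ X hX h => key j X hX fun v hv => ?_
        have := h v hv
        rwa [Function.update_self] at this
    _ = 1 / (p : ℝ) ^ 2 := by ring

lemma dens_exists_dvd_dvd_le (N : ι → ℕ) {i j : ι} (hij : i ≠ j) {M : ℕ} (hM : M ≠ 0) :
    dens N (fun x => ∃ p : ℕ, M < p ∧ (x i ≠ 0 ∧ (p : ℤ) ∣ x i) ∧ (x j ≠ 0 ∧ (p : ℤ) ∣ x j)) ≤
      1 / M := by
  refine le_trans (dens_mono (Q := fun x => ∃ p ∈ Finset.Ioc M (N i),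
    (x i ≠ 0 ∧ (p : ℤ) ∣ x i) ∧ (x j ≠ 0 ∧ (p : ℤ) ∣ x j)) ?_) ?_
  · rintro x hx ⟨p, hp, h⟩
    refine ⟨p, Finset.mem_Ioc.2 ⟨hp, ?_⟩, h⟩
    have h1 : (p : ℤ) ≤ |x i| := Int.le_of_dvd (abs_pos.2 h.1.1) ((dvd_abs _ _).2 h.1.2)
    exact_mod_cast h1.trans (mem_cube.1 hx i)
  · refine (dens_exists_le _ _ _).trans ((Finset.sum_le_sum fun p hp => ?_).trans
      (sum_Ioc_inv_sq_le_inv hM (N i)))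
    exact dens_dvd_dvd_le N hij (by have := (Finset.mem_Ioc.1 hp).1; omega)

lemma exists_prime_not_dvd {a : ℤ} (ha : a ≠ 0) (M : ℕ) :
    ∃ p : ℕ, p.Prime ∧ M < p ∧ ¬ (p : ℤ) ∣ a := by
  obtain ⟨p, hp, hpp⟩ := Nat.exists_infinite_primes (M + a.natAbs + 1)
  refine ⟨p, hpp, by omega, fun h => ?_⟩
  have := Nat.le_of_dvd (Int.natAbs_pos.2 ha) (Int.natCast_dvd.1 h)
  omega

lemma sum_biUnion_le_sum {κ α : Type*} [DecidableEq α] (s : Finset κ) (t : κ → Finset α)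
    {f : α → ℝ} (hf : ∀ a, 0 ≤ f a) : ∑ a ∈ s.biUnion t, f a ≤ ∑ k ∈ s, ∑ a ∈ t k, f a := by
  classical
  induction s using Finset.induction_on with
  | empty => simp
  | insert k s hk ih =>
    rw [Finset.biUnion_insert, Finset.sum_insert hk]
    have := Finset.sum_union_inter (s₁ := t k) (s₂ := s.biUnion t) (f := f)
    have h2 : 0 ≤ ∑ a ∈ t k ∩ s.biUnion t, f a := Finset.sum_nonneg fun a _ => hf a
    linarith

/-- The sum of the reciprocals of the prime divisors of `a` exceeding `M`. -/
def primeWeight (M : ℕ) (a : ℤ) : ℝ := ∑ p ∈ a.natAbs.primeFactors with M < p, 1 / (p : ℝ)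

lemma primeWeight_le {M Z : ℕ} (hM : M ≠ 0) (hMZ : 5 ≤ Z) {a : ℤ} (ha : a ≠ 0)
    (haZ : |a| ≤ 5 * (Z : ℤ) ^ 2) :
    primeWeight M a ≤ 2 / M + ∑ p ∈ (Finset.Ioc M Z).filter Nat.Prime,
      1 / (p : ℝ) * ind ((p : ℤ) ∣ a) := by
  classical
  set S := a.natAbs.primeFactors.filter (M < ·)
  have hmem {p : ℕ} (hp : p ∈ S) : p.Prime ∧ (p : ℤ) ∣ a ∧ M < p := by
    have := Finset.mem_filter.1 hp
    have h1 := Nat.mem_primeFactors.1 this.1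
    exact ⟨h1.1, Int.natCast_dvd.2 h1.2.1, this.2⟩
  have hcard : (S.filter (Z < ·)).card ≤ 2 := by
    by_contra! h
    obtain ⟨U, hU, hU3⟩ := Finset.exists_subset_card_eq h
    have h1 : ∏ p ∈ U, p ∣ a.natAbs :=
      (Finset.prod_dvd_prod_of_subset _ _ _ (hU.trans ((Finset.filter_subset _ _).trans
        (Finset.filter_subset _ _)))).trans (Nat.prod_primeFactors_dvd _)
    have h2 := Nat.le_of_dvd (Int.natAbs_pos.2 ha) h1
    have h3 : (Z + 1) ^ U.card ≤ ∏ p ∈ U, p := Finset.pow_card_le_prod _ _ _ fun p hp =>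
      (Finset.mem_filter.1 (hU hp)).2
    rw [hU3] at h3
    have h4 : (a.natAbs : ℤ) ≤ 5 * (Z : ℤ) ^ 2 := by rwa [Int.natCast_natAbs]
    have h5 : a.natAbs ≤ 5 * Z ^ 2 := by exact_mod_cast h4
    nlinarith [Nat.mul_le_mul_right (Z ^ 2) hMZ]
  have hM' : (0 : ℝ) < M := by positivity
  have hlarge : ∑ p ∈ S.filter (Z < ·), 1 / (p : ℝ) ≤ 2 / M := by
    have h1 : ∀ p ∈ S.filter (Z < ·), 1 / (p : ℝ) ≤ 1 / M := fun p hp => by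
      have := (hmem (Finset.mem_filter.1 hp).1).2.2
      have h2 : (M : ℝ) ≤ p := by exact_mod_cast this.le
      gcongr
    refine (Finset.sum_le_card_nsmul _ _ _ h1).trans ?_
    rw [nsmul_eq_mul, mul_one_div]
    have : (((S.filter (Z < ·)).card : ℕ) : ℝ) ≤ 2 := by exact_mod_cast hcard
    gcongr
  have hsmall : ∑ p ∈ S.filter (¬ Z < ·), 1 / (p : ℝ) ≤
      ∑ p ∈ (Finset.Ioc M Z).filter Nat.Prime, 1 / (p : ℝ) * ind ((p : ℤ) ∣ a) := by
    have h1 : ∀ p ∈ S.filter (¬ Z < ·), 1 / (p : ℝ) = 1 / (p : ℝ) * ind ((p : ℤ) ∣ a) :=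
      fun p hp => by rw [ind_of (hmem (Finset.mem_filter.1 hp).1).2.1, mul_one]
    rw [Finset.sum_congr rfl h1]
    refine Finset.sum_le_sum_of_subset_of_nonneg (fun p hp => ?_) fun p _ _ =>
      mul_nonneg (by positivity) (ind_nonneg _)
    have h2 := Finset.mem_filter.1 hp
    have h3 := hmem h2.1
    exact Finset.mem_filter.2 ⟨Finset.mem_Ioc.2 ⟨h3.2.2, not_lt.1 h2.2⟩, h3.1⟩
  have := Finset.sum_filter_add_sum_filter_not S (Z < ·) fun p => 1 / (p : ℝ)
  rw [primeWeight]
  linarith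

namespace QuadraticFiber

variable {R : (ι → ℤ) → ℤ} {n : ι} {κ : Type*} [Fintype κ] (Q : QuadraticFiber R n κ)

lemma dens_q_eq_zero_le (N : ι → ℕ) (M : ℕ) (k : κ) {i : ι} (hi : i ∈ Q.J k) :
    dens N (fun x => Generic n M x ∧ Q.q k x = 0) ≤ 4 / (2 * N i + 1) := by
  refine dens_le_of_fiber i fun x _ X hXN hX => ?_
  have hp : (0 : ℝ) < 2 * N i + 1 := by positivity
  rw [mul_div_cancel₀ _ hp.ne']
  rcases X.eq_empty_or_nonempty with h | ⟨w, hw⟩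
  · rw [h]; simp
  have hsq : ∀ v ∈ X, v = w ∨ v = -w := fun v hv => by
    rw [← sq_eq_sq_iff_eq_or_eq_neg]
    by_contra h
    obtain ⟨p, hp, hMp, hpd⟩ := exists_prime_not_dvd (sub_ne_zero.2 h) (M + 2)
    have h1 := hX v hv
    have h2 := hX w hw
    refine hpd (Q.q_class k i hi x v w p hp (by omega) (h1.1.2 p hp (by omega))
      (h2.1.2 p hp (by omega)) ?_ ?_)
    · rw [h1.2]; exact dvd_zero _
    · rw [h2.2]; exact dvd_zero _
  have h := card_le_of_two_classes (X := X) (m := 2 * N i + 1) (by omega)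
    hXN hsq (fun v _ y _ h1 h2 => by simp [h1, h2])
    (fun v _ y _ h1 h2 => by simp [h1, h2])
  push_cast at h
  rw [div_self hp.ne'] at h
  linarith

lemma dens_dvd_q_le (N : ι → ℕ) {M : ℕ} (hM : 2 ≤ M) (k : κ) {i : ι} (hi : i ∈ Q.J k) {p : ℕ}
    (hp : p.Prime) (hMp : M < p) (hpN : p ≤ N i) :
    dens N (fun x => Generic n M x ∧ (p : ℤ) ∣ Q.q k x) ≤ 4 / p := by
  refine dens_le_of_fiber i fun x _ X hXN hX => ?_
  have hp' : (0 : ℝ) < p := by exact_mod_cast hp.pos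
  rcases X.eq_empty_or_nonempty with h | ⟨w, hw⟩
  · rw [h, Finset.card_empty, Nat.cast_zero]; positivity
  have hsq : ∀ v ∈ X, (p : ℤ) ∣ v - w ∨ (p : ℤ) ∣ v + w := fun v hv => by
    have h1 := hX v hv
    have h2 := hX w hw
    have h3 := Q.q_class k i hi x v w p hp (by omega) (h1.1.2 p hp hMp) (h2.1.2 p hp hMp)
      h1.2 h2.2
    rw [sq_sub_sq, mul_comm] at h3
    exact (Nat.prime_iff_prime_int.1 hp).dvd_or_dvd h3
  have h := card_le_of_two_classes (X := X) hp.pos hXN hsq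
    (fun v _ y _ h1 h2 => (dvd_sub h1 h2).trans (dvd_of_eq (by ring)))
    (fun v _ y _ h1 h2 => (dvd_sub h1 h2).trans (dvd_of_eq (by ring)))
  refine h.trans ?_
  have h4 : (1 : ℝ) ≤ (2 * N i + 1) / p := by
    rw [one_le_div hp']
    have : (p : ℝ) ≤ N i := by exact_mod_cast hpN
    linarith
  have h5 : (2 * (N i : ℝ) + 1) * (4 / p) = 4 * ((2 * N i + 1) / p) := by ring
  linarith

lemma avg_primeWeight_le (N : ι → ℕ) (hN : ∀ i, 5 ≤ N i) {M : ℕ} (hM : 2 ≤ M) (k : κ) :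
    avg N (fun x => ind (Generic n M x ∧ Q.q k x ≠ 0) * primeWeight M (Q.q k x)) ≤ 6 / M := by
  obtain ⟨i, hi, hmax⟩ := Finset.exists_max_image (Q.J k) N (Q.J_nonempty k)
  have hM0 : M ≠ 0 := by omega
  set P := (Finset.Ioc M (N i)).filter Nat.Prime with hP
  calc avg N (fun x => ind (Generic n M x ∧ Q.q k x ≠ 0) * primeWeight M (Q.q k x))
      ≤ avg N fun x => 2 / M + ∑ p ∈ P, 1 / (p : ℝ) * ind (Generic n M x ∧ (p : ℤ) ∣ Q.q k x) := by
        refine avg_mono fun x hx => ?_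
        by_cases h : Generic n M x ∧ Q.q k x ≠ 0
        · rw [ind_of h, one_mul]
          refine (primeWeight_le hM0 (hN i) h.2 (Q.q_bound k x (N i) fun j hj => ?_)).trans_eq ?_
          · exact (mem_cube.1 hx j).trans (by exact_mod_cast hmax j hj)
          · simp only [h.1, true_and, hP]
        · rw [ind_of_not h, zero_mul]
          have : 0 ≤ ∑ p ∈ P, 1 / (p : ℝ) * ind (Generic n M x ∧ (p : ℤ) ∣ Q.q k x) :=
            Finset.sum_nonneg fun p _ => mul_nonneg (by positivity) (ind_nonneg _)
          positivity
    _ = 2 / M + ∑ p ∈ P, 1 / (p : ℝ) * dens N fun x => Generic n M x ∧ (p : ℤ) ∣ Q.q k x := by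
        rw [avg_add, avg_const, avg_sum]
        simp only [avg_const_mul, dens]
    _ ≤ 2 / M + ∑ p ∈ P, 4 * (1 / (p : ℝ) ^ 2) := by
        refine add_le_add le_rfl (Finset.sum_le_sum fun p hp => ?_)
        have h1 := Finset.mem_filter.1 hp
        have h2 := Finset.mem_Ioc.1 h1.1
        have := Q.dens_dvd_q_le N hM k hi h1.2 h2.1 h2.2
        calc 1 / (p : ℝ) * dens N (fun x => Generic n M x ∧ (p : ℤ) ∣ Q.q k x)
            ≤ 1 / (p : ℝ) * (4 / p) := by gcongr
          _ = _ := by ring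
    _ ≤ 2 / M + 4 * (1 / M) := by
        rw [← Finset.mul_sum]
        gcongr
        exact (Finset.sum_le_sum_of_subset_of_nonneg (Finset.filter_subset _ _)
          fun _ _ _ => by positivity).trans (sum_Ioc_inv_sq_le_inv hM0 _)
    _ = 6 / M := by ring

end QuadraticFiber

end Tail

section TailBound

variable {ι : Type*} [DecidableEq ι]

/-- The integer `a` is zero or divisible by the square of a prime exceeding `M`. -/
def LargeSquareDvd (M : ℕ) (a : ℤ) : Prop :=
  a = 0 ∨ ∃ p : ℕ, p.Prime ∧ M < p ∧ (p : ℤ) ^ 2 ∣ a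

lemma tendsto_const_div_coord {ι : Type*} (c : ℝ) (i : ι) :
    Tendsto (fun N : ι → ℕ => c / (2 * (N i : ℝ) + 1)) atTop (nhds 0) := by
  have h1 : Tendsto (fun N : ι → ℕ => N i) atTop atTop := tendsto_atTop.2 fun b => (eventually_ge_atTop fun _ => b).mono fun N hN => hN i
  have h2 : Tendsto (fun N : ι → ℕ => (2 * (N i : ℝ) + 1)) atTop atTop :=
    tendsto_atTop_add_const_right _ _
      ((tendsto_natCast_atTop_atTop.comp h1).const_mul_atTop two_pos)
  exact h2.const_div_atTop c

namespace QuadraticFiber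

variable {R : (ι → ℤ) → ℤ} {n : ι} {κ : Type*} [Fintype κ] (Q : QuadraticFiber R n κ)

lemma eventually_fiber_le {M : ℕ} (hM : 2 ≤ M) {x : ι → ℤ} (hx : Generic n M x)
    (hq : ∀ k, Q.q k x ≠ 0) :
    ∀ᶠ T : ℕ in atTop, ∑ v ∈ symmIcc T, ind (LargeSquareDvd M (R (Function.update x n v))) ≤
      (2 * T + 1) * (3 / M + ∑ k, primeWeight M (Q.q k x)) := by
  classical
  have hP : (∏ k, Q.q k x) ^ 2 ≠ 0 := pow_ne_zero _ (Finset.prod_ne_zero_iff.2 fun k _ => hq k)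
  have hAD := ne_zero_of_dvd_ne_zero hP (Q.disc_dvd x)
  have hM' : (0 : ℝ) < 1 / M := by have : 0 < M := by omega
                                   positivity
  have key := eventually_card_quadratic_le (C := Q.C x) (left_ne_zero_of_mul hAD)
    (right_ne_zero_of_mul hAD) (M := M) (by omega) (fun p hp hMp hpd v w h1 h2 =>
      Q.singular x v w p hp (by omega) (hx.2 p hp hMp) hpd (by rwa [Q.eval]) (by rwa [Q.eval])) hM'
  filter_upwards [key] with T hT
  have hsum : ∑ p ∈ (Q.A x * (Q.B x ^ 2 - 4 * Q.A x * Q.C x)).natAbs.primeFactors with M < p,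
      1 / (p : ℝ) ≤ ∑ k, primeWeight M (Q.q k x) := by
    unfold primeWeight
    refine le_trans (Finset.sum_le_sum_of_subset_of_nonneg (fun p hp => ?_)
      fun p _ _ => by positivity) (sum_biUnion_le_sum Finset.univ
        (fun k => (Q.q k x).natAbs.primeFactors.filter (M < ·)) fun p => by positivity)
    have h1 := Finset.mem_filter.1 hp
    have h2 := Nat.mem_primeFactors.1 h1.1
    have hpp := Nat.prime_iff_prime_int.1 h2.1
    obtain ⟨k, -, hk⟩ := (Prime.dvd_finsetProd_iff hpp _).1
      (hpp.dvd_of_dvd_pow ((Int.natCast_dvd.2 h2.2.1).trans (Q.disc_dvd x)))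
    exact Finset.mem_biUnion.2 ⟨k, Finset.mem_univ _, Finset.mem_filter.2
      ⟨Nat.mem_primeFactors.2 ⟨h2.1, Int.natCast_dvd.1 hk, Int.natAbs_ne_zero.2 (hq k)⟩, h1.2⟩⟩
  have h32 : (2 : ℝ) / M + 1 / M = 3 / M := by ring
  refine (sum_ind_le fun X hX h => (Nat.cast_le.2 (Finset.card_le_card fun v hv => ?_)).trans
    hT).trans (mul_le_mul_of_nonneg_left (by linarith) (by positivity))
  have := h v hv
  rw [LargeSquareDvd, Q.eval] at this
  exact Finset.mem_filter.2 ⟨hX hv, this⟩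

variable [Fintype ι]

lemma eventually_dens_nonsingular_le {M : ℕ} (hM : 2 ≤ M) :
    ∀ᶠ N in iterAtTop n, dens N (fun x => (Generic n M x ∧ ∀ k, Q.q k x ≠ 0) ∧
      LargeSquareDvd M (R x)) ≤ 3 / M + Fintype.card κ * (6 / M) := by
  refine eventually_iterAtTop.2 ?_
  filter_upwards [eventually_ge_atTop fun _ => 5] with s hs
  have hfib : ∀ᶠ T : ℕ in atTop, ∀ y ∈ cube (Function.update s n 0),
      (Generic n M y ∧ ∀ k, Q.q k y ≠ 0) →
      ∑ v ∈ symmIcc T, ind (LargeSquareDvd M (R (Function.update y n v))) ≤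
      (2 * T + 1) * (3 / M + ∑ k, primeWeight M (Q.q k y)) := by
    refine (Finset.eventually_all _).2 fun y _ => ?_
    by_cases hy : Generic n M y ∧ ∀ k, Q.q k y ≠ 0
    · filter_upwards [Q.eventually_fiber_le hM hy.1 hy.2] with T hT _ using hT
    · exact Eventually.of_forall fun T h => absurd h hy
  filter_upwards [hfib, eventually_ge_atTop 5] with T hT hT5
  set N := Function.update s n T with hN
  have hN5 : ∀ i, 5 ≤ N i := fun i => by
    rcases eq_or_ne i n with rfl | h
    · simpa [hN] using hT5
    · simpa [hN, h] using hs i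
  have hiff (x : ι → ℤ) (v : ℤ) : (Generic n M (Function.update x n v) ∧
      ∀ k, Q.q k (Function.update x n v) ≠ 0) ↔ Generic n M x ∧ ∀ k, Q.q k x ≠ 0 := by
    simp only [generic_update, Q.q_update]
  calc dens N (fun x => (Generic n M x ∧ ∀ k, Q.q k x ≠ 0) ∧ LargeSquareDvd M (R x))
      ≤ avg N fun x => ind (Generic n M x ∧ ∀ k, Q.q k x ≠ 0) *
          (3 / M + ∑ k, primeWeight M (Q.q k x)) := by
        refine avg_le_avg_of_fiber n fun x hx => ?_
        simp only [hiff]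
        by_cases h : Generic n M x ∧ ∀ k, Q.q k x ≠ 0
        · have h0 : Function.update x n 0 ∈ cube (Function.update s n 0) := by
            refine mem_cube.2 fun i => ?_
            rcases eq_or_ne i n with rfl | hi
            · simp
            · simpa [hi, hN] using mem_cube.1 hx i
          have := hT _ h0 ((hiff x 0).2 h)
          simp only [Function.update_idem, Q.q_update] at this
          simpa only [h, true_and, ne_eq, implies_true, ind_of, one_mul, hN, Function.update_self,
            not_false_eq_true] using this
        · rw [ind_of_not h, zero_mul, mul_zero]
          exact (Finset.sum_eq_zero fun v _ => ind_of_not fun h' => h h'.1).le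
    _ ≤ avg N fun x => 3 / M + ∑ k, ind (Generic n M x ∧ Q.q k x ≠ 0) *
          primeWeight M (Q.q k x) := by
        refine avg_mono fun x _ => ?_
        have hw (k : κ) : 0 ≤ primeWeight M (Q.q k x) := Finset.sum_nonneg fun _ _ => by positivity
        by_cases h : Generic n M x ∧ ∀ k, Q.q k x ≠ 0
        · rw [ind_of h, one_mul]
          refine add_le_add le_rfl (Finset.sum_le_sum fun k _ => ?_)
          rw [ind_of ⟨h.1, h.2 k⟩, one_mul]
        · rw [ind_of_not h, zero_mul]
          have : 0 ≤ ∑ k, ind (Generic n M x ∧ Q.q k x ≠ 0) * primeWeight M (Q.q k x) :=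
            Finset.sum_nonneg fun k _ => mul_nonneg (ind_nonneg _) (hw k)
          positivity
    _ = 3 / M + ∑ k, avg N fun x => ind (Generic n M x ∧ Q.q k x ≠ 0) *
          primeWeight M (Q.q k x) := by
        rw [avg_add, avg_const, avg_sum]
    _ ≤ 3 / M + ∑ _k : κ, (6 : ℝ) / M :=
        add_le_add le_rfl (Finset.sum_le_sum fun k _ => Q.avg_primeWeight_le N hN5 hM k)
    _ = 3 / M + Fintype.card κ * (6 / M) := by simp

lemma dens_largeSquareDvd_le (N : ι → ℕ) {M : ℕ} (hM : M ≠ 0) {i : κ → ι}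
    (hi : ∀ k, i k ∈ Q.J k) :
    dens N (fun x => LargeSquareDvd M (R x)) ≤
      ∑ j, 1 / (2 * (N j : ℝ) + 1) + ∑ k, 4 / (2 * (N (i k) : ℝ) + 1) +
      Fintype.card (ι × ι) * (1 / (M : ℝ)) +
      dens N (fun x => (Generic n M x ∧ ∀ k, Q.q k x ≠ 0) ∧ LargeSquareDvd M (R x)) := by
  classical
  set S : Finset (ι × ι) := Finset.univ.filter fun a => a.1 ≠ a.2 with hS
  have h0 := (dens_exists_le N Finset.univ fun (j : ι) x => x j = 0).trans
    (Finset.sum_le_sum fun j _ => dens_eq_zero_le N j)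
  have h1 := (dens_exists_le N Finset.univ fun (k : κ) x => Generic n M x ∧ Q.q k x = 0).trans
    (Finset.sum_le_sum fun k _ => Q.dens_q_eq_zero_le N M k (hi k))
  have h2 := (dens_exists_le N S fun a x => ∃ p : ℕ, M < p ∧
      (x a.1 ≠ 0 ∧ (p : ℤ) ∣ x a.1) ∧ (x a.2 ≠ 0 ∧ (p : ℤ) ∣ x a.2)).trans
    (Finset.sum_le_sum fun a ha => dens_exists_dvd_dvd_le N (Finset.mem_filter.1 ha).2 hM)
  have h3 : ∑ a ∈ S, 1 / (M : ℝ) ≤ Fintype.card (ι × ι) * (1 / (M : ℝ)) := by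
    rw [Finset.sum_const, nsmul_eq_mul]
    have : (S.card : ℝ) ≤ Fintype.card (ι × ι) := by exact_mod_cast Finset.card_le_univ S
    gcongr
  refine (dens_mono (Q := fun x => (∃ j ∈ Finset.univ, x j = 0) ∨
    (∃ k ∈ Finset.univ, Generic n M x ∧ Q.q k x = 0) ∨ (∃ a ∈ S, ∃ p : ℕ, M < p ∧
      (x a.1 ≠ 0 ∧ (p : ℤ) ∣ x a.1) ∧ (x a.2 ≠ 0 ∧ (p : ℤ) ∣ x a.2)) ∨
    ((Generic n M x ∧ ∀ k, Q.q k x ≠ 0) ∧ LargeSquareDvd M (R x))) fun x _ hx => ?_).trans ?_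
  · by_cases hz : ∃ j, x j = 0
    · obtain ⟨j, hj⟩ := hz
      exact Or.inl ⟨j, Finset.mem_univ _, hj⟩
    push Not at hz
    by_cases hg : Generic n M x
    · by_cases hk : ∀ k, Q.q k x ≠ 0
      · exact Or.inr (Or.inr (Or.inr ⟨⟨hg, hk⟩, hx⟩))
      · push Not at hk
        obtain ⟨k, hk⟩ := hk
        exact Or.inr (Or.inl ⟨k, Finset.mem_univ _, hg, hk⟩)
    · refine Or.inr (Or.inr (Or.inl ?_))
      simp only [Generic, AlmostCoprime, not_and, not_forall] at hg
      obtain ⟨p, -, hMp, a, b, -, -, hab, ha, hb⟩ := hg fun j _ => hz j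
      exact ⟨(a, b), Finset.mem_filter.2 ⟨Finset.mem_univ _, hab⟩, p, hMp, ⟨hz a, ha⟩, hz b,
        not_not.1 hb⟩
  · have e1 := dens_or_le N (fun x => ∃ j ∈ Finset.univ, x j = 0) fun x =>
      (∃ k ∈ Finset.univ, Generic n M x ∧ Q.q k x = 0) ∨ (∃ a ∈ S, ∃ p : ℕ, M < p ∧
      (x a.1 ≠ 0 ∧ (p : ℤ) ∣ x a.1) ∧ (x a.2 ≠ 0 ∧ (p : ℤ) ∣ x a.2)) ∨
      ((Generic n M x ∧ ∀ k, Q.q k x ≠ 0) ∧ LargeSquareDvd M (R x))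
    have e2 := dens_or_le N (fun x => ∃ k ∈ Finset.univ, Generic n M x ∧ Q.q k x = 0) fun x =>
      (∃ a ∈ S, ∃ p : ℕ, M < p ∧
      (x a.1 ≠ 0 ∧ (p : ℤ) ∣ x a.1) ∧ (x a.2 ≠ 0 ∧ (p : ℤ) ∣ x a.2)) ∨
      ((Generic n M x ∧ ∀ k, Q.q k x ≠ 0) ∧ LargeSquareDvd M (R x))
    have e3 := dens_or_le N (fun x => ∃ a ∈ S, ∃ p : ℕ, M < p ∧
      (x a.1 ≠ 0 ∧ (p : ℤ) ∣ x a.1) ∧ (x a.2 ≠ 0 ∧ (p : ℤ) ∣ x a.2)) fun x =>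
      ((Generic n M x ∧ ∀ k, Q.q k x ≠ 0) ∧ LargeSquareDvd M (R x))
    linarith

theorem eventually_dens_largeSquareDvd_le (Q : QuadraticFiber R n κ) {M : ℕ} (hM : 2 ≤ M) :
    ∀ᶠ N in iterAtTop n, dens N (fun x => LargeSquareDvd M (R x)) ≤
      (4 + Fintype.card κ * 6 + Fintype.card (ι × ι)) / M := by
  choose i hi using Q.J_nonempty
  have hM' : (0 : ℝ) < 1 / M := by have : 0 < M := by omega
                                   positivity
  have hlim : Tendsto (fun N : ι → ℕ => ∑ j, 1 / (2 * (N j : ℝ) + 1) +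
      ∑ k, 4 / (2 * (N (i k) : ℝ) + 1)) atTop (nhds 0) := by
    simpa using (tendsto_finsetSum Finset.univ fun j _ => tendsto_const_div_coord 1 j).add
      (tendsto_finsetSum Finset.univ fun k _ => tendsto_const_div_coord (ι := ι) 4 (i k))
  filter_upwards [Q.eventually_dens_nonsingular_le hM,
    iterAtTop_le_atTop n (hlim.eventually_le_const hM')] with N h1 h2
  have h3 := Q.dens_largeSquareDvd_le N (M := M) (by omega) hi
  have : (4 + Fintype.card κ * 6 + Fintype.card (ι × ι) : ℝ) / M =
    1 / M + Fintype.card (ι × ι) * (1 / M) + (3 / M + Fintype.card κ * (6 / M)) := by ring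
  linarith

end QuadraticFiber

end TailBound

section Resultant

lemma resEval_two {R : Type*} [CommRing R] (Q : Fin (2 * 2 + 2) → R) :
    resEval 2 Q = (Q 0 * Q 5 - Q 2 * Q 3) ^ 2 -
      (Q 0 * Q 4 - Q 1 * Q 3) * (Q 1 * Q 5 - Q 2 * Q 4) := by
  have h : resEval 2 Q = (sylvesterMat 2 Q).det := by
    rw [resEval, resPoly, AlgHom.map_det]
    congr 1
    ext i j
    simp only [sylvesterMat, AlgHom.mapMatrix_apply, Matrix.map_apply, Matrix.of_apply]
    split_ifs <;> simp
  have hm : sylvesterMat 2 Q = !![Q 0, Q 1, Q 2, 0; 0, Q 0, Q 1, Q 2; Q 3, Q 4, Q 5, 0;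
      0, Q 3, Q 4, Q 5] := by
    ext i j
    fin_cases i <;> fin_cases j <;> rfl
  rw [h, hm]
  simp [Matrix.det_succ_row_zero, Fin.sum_univ_succ, Fin.succAbove, Matrix.submatrix_apply]
  ring

lemma prime_dvd_sub_of_dvd_disc {A B C v w p : ℤ} (hp : Prime p) (h2 : ¬ p ∣ 2) (hA : ¬ p ∣ A)
    (hD : p ∣ B ^ 2 - 4 * A * C) (hv : p ∣ A * v ^ 2 + B * v + C)
    (hw : p ∣ A * w ^ 2 + B * w + C) : p ∣ v - w := by
  have key (t : ℤ) (ht : p ∣ A * t ^ 2 + B * t + C) : p ∣ 2 * A * t + B := by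
    refine hp.dvd_of_dvd_pow (n := 2) ?_
    exact (dvd_add (ht.mul_left (4 * A)) hD).trans (dvd_of_eq (by ring))
  have h : p ∣ 2 * A * (v - w) := (dvd_sub (key v hv) (key w hw)).trans (dvd_of_eq (by ring))
  rcases hp.dvd_or_dvd h with h | h
  · exact ((hp.dvd_or_dvd h).elim h2 hA).elim
  · exact h

end Resultant

section ResultantFibers

lemma Prime.dvd_sub_of_dvd_mul_sub {p a v w : ℤ} (hp : Prime p) (ha : ¬ p ∣ a)
    (h : p ∣ a * (v - w)) : p ∣ v ^ 2 - w ^ 2 := by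
  have h1 := (hp.dvd_or_dvd h).resolve_left ha
  exact (h1.mul_left (v + w)).trans (dvd_of_eq (by ring))

lemma not_intCast_dvd_two {p : ℕ} (hp : 2 < p) : ¬ (p : ℤ) ∣ 2 := fun h => by
  have := Int.le_of_dvd two_pos h
  omega

lemma not_dvd_four {p : ℕ} (hp : p.Prime) (h2 : 2 < p) : ¬ (p : ℤ) ∣ 4 := fun h =>
  not_intCast_dvd_two h2 ((Nat.prime_iff_prime_int.1 hp).dvd_of_dvd_pow (n := 2) h)

/-- The resultant as a quadratic polynomial in the leading coefficient of the first form. -/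
def fiberZero : QuadraticFiber (fun x => resEval 2 x) (0 : Fin (2 * 2 + 2)) (Fin 3) where
  A x := x 5 ^ 2
  B x := -(x 1 * x 4 * x 5) - 2 * x 2 * x 3 * x 5 + x 2 * x 4 ^ 2
  C x := x 2 ^ 2 * x 3 ^ 2 - x 1 * x 2 * x 3 * x 4 + x 1 ^ 2 * x 3 * x 5
  q := ![fun x => x 5, fun x => x 4 ^ 2 - 4 * x 3 * x 5, fun x => x 1 * x 5 - x 2 * x 4]
  J := ![{5}, {3, 4, 5}, {1, 2, 4, 5}]
  eval x t := by
    rw [resEval_two]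
    simp
    ring
  disc_dvd x := by
    simp only [Fin.prod_univ_three]
    exact Dvd.intro (x 4 ^ 2 - 4 * x 3 * x 5) (by simp; ring)
  J_nonempty k := by fin_cases k <;> simp
  q_update k x t := by fin_cases k <;> simp
  q_bound k x Z h := by
    fin_cases k <;> simp [abs_le] at h ⊢
    · constructor <;> nlinarith [Int.le_self_sq Z]
    · obtain ⟨h3, h4, h5⟩ := h
      constructor <;> nlinarith
    · obtain ⟨h1, h2, h4, h5⟩ := h
      constructor <;> nlinarith
  q_class k i hi x v w p hp h2 hv hw h3 h4 := by
    have hpp := Nat.prime_iff_prime_int.1 hp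
    have h4' := not_dvd_four hp h2
    fin_cases k <;> simp at hi
    · subst hi
      simp at h3 h4
      exact (dvd_sub (h3.mul_left v) (h4.mul_left w)).trans (dvd_of_eq (by ring))
    · have hco := hv 4 5 (by decide) (by decide) (by decide)
      have hco' := hv 4 3 (by decide) (by decide) (by decide)
      rcases hi with rfl | rfl | rfl <;> simp at h3 h4 hco hco'
      · refine Prime.dvd_sub_of_dvd_mul_sub (a := 4 * x 5) hpp (fun h => ?_)
          ((dvd_sub h4 h3).trans (dvd_of_eq (by ring)))
        have h5 := (hpp.dvd_or_dvd h).resolve_left h4'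
        refine hco (hpp.dvd_of_dvd_pow (n := 2) ?_) h5
        exact (dvd_add h3 (h5.mul_left (4 * v))).trans (dvd_of_eq (by ring))
      · exact (dvd_sub h3 h4).trans (dvd_of_eq (by ring))
      · refine Prime.dvd_sub_of_dvd_mul_sub (a := 4 * x 3) hpp (fun h => ?_)
          ((dvd_sub h4 h3).trans (dvd_of_eq (by ring)))
        have h5 := (hpp.dvd_or_dvd h).resolve_left h4'
        refine hco' (hpp.dvd_of_dvd_pow (n := 2) ?_) h5
        exact (dvd_add h3 (h5.mul_left (4 * v))).trans (dvd_of_eq (by ring))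
    · have h52 := hv 5 2 (by decide) (by decide) (by decide)
      have h54 := hv 5 4 (by decide) (by decide) (by decide)
      have h41 := hv 4 1 (by decide) (by decide) (by decide)
      have h12 := hv 1 2 (by decide) (by decide) (by decide)
      rcases hi with rfl | rfl | rfl | rfl <;> simp at h3 h4 h52 h54 h41 h12
      · refine Prime.dvd_sub_of_dvd_mul_sub (a := x 5) hpp (fun h => ?_)
          ((dvd_sub h3 h4).trans (dvd_of_eq (by ring)))
        have h5 : (p : ℤ) ∣ x 2 * x 4 :=
          (dvd_sub (h.mul_left v) h3).trans (dvd_of_eq (by ring))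
        exact (hpp.dvd_or_dvd h5).elim (h52 h) (h54 h)
      · refine Prime.dvd_sub_of_dvd_mul_sub (a := x 4) hpp (fun h => ?_)
          ((dvd_sub h4 h3).trans (dvd_of_eq (by ring)))
        have h5 : (p : ℤ) ∣ x 1 * x 5 :=
          (dvd_add (h.mul_left v) h3).trans (dvd_of_eq (by ring))
        exact (hpp.dvd_or_dvd h5).elim (h41 h) (fun h' => h54 h' h)
      · refine Prime.dvd_sub_of_dvd_mul_sub (a := x 2) hpp (fun h => ?_)
          ((dvd_sub h4 h3).trans (dvd_of_eq (by ring)))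
        have h5 : (p : ℤ) ∣ x 1 * x 5 :=
          (dvd_add (h.mul_left v) h3).trans (dvd_of_eq (by ring))
        exact (hpp.dvd_or_dvd h5).elim (fun h' => h12 h' h) (fun h' => h52 h' h)
      · refine Prime.dvd_sub_of_dvd_mul_sub (a := x 1) hpp (fun h => ?_)
          ((dvd_sub h3 h4).trans (dvd_of_eq (by ring)))
        have h5 : (p : ℤ) ∣ x 2 * x 4 :=
          (dvd_sub (h.mul_left v) h3).trans (dvd_of_eq (by ring))
        exact (hpp.dvd_or_dvd h5).elim (h12 h) (fun h' => h41 h' h)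
  singular x v w p hp h2 hx hAD hv hw := by
    have hpp := Nat.prime_iff_prime_int.1 hp
    have hv' := (dvd_pow_self (p : ℤ) two_ne_zero).trans hv
    have hw' := (dvd_pow_self (p : ℤ) two_ne_zero).trans hw
    rw [resEval_two] at hv' hw'
    simp at hv' hw'
    by_cases h5 : (p : ℤ) ∣ x 5
    · have h52 := hx 5 2 (by decide) (by decide) (by decide) h5
      have h54 := hx 5 4 (by decide) (by decide) (by decide) h5
      have h : (p : ℤ) ∣ x 2 * x 4 ^ 2 * (v - w) :=
        (dvd_sub (dvd_sub hv' hw') (h5.mul_right ((v - w) * (x 5 * (v + w) - x 1 * x 4 -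
          2 * x 2 * x 3)))).trans (dvd_of_eq (by ring))
      refine (hpp.dvd_or_dvd h).resolve_left fun h => ?_
      exact (hpp.dvd_or_dvd h).elim h52 fun h => h54 (hpp.dvd_of_dvd_pow h)
    · have hA : ¬ (p : ℤ) ∣ x 5 ^ 2 := fun h => h5 (hpp.dvd_of_dvd_pow h)
      exact prime_dvd_sub_of_dvd_disc hpp (not_intCast_dvd_two h2) hA
        ((hpp.dvd_or_dvd hAD).resolve_left hA) (hv'.trans (dvd_of_eq (by ring)))
        (hw'.trans (dvd_of_eq (by ring)))

/-- The resultant as a quadratic polynomial in the middle coefficient of the first form. -/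
def fiberOne : QuadraticFiber (fun x => resEval 2 x) (1 : Fin (2 * 2 + 2)) (Fin 4) where
  A x := x 3 * x 5
  B x := -(x 4 * (x 0 * x 5 + x 2 * x 3))
  C x := (x 0 * x 5 - x 2 * x 3) ^ 2 + x 0 * x 2 * x 4 ^ 2
  q := ![fun x => x 3, fun x => x 5, fun x => x 4 ^ 2 - 4 * x 3 * x 5,
    fun x => x 0 * x 5 - x 2 * x 3]
  J := ![{3}, {5}, {3, 4, 5}, {0, 2, 3, 5}]
  eval x t := by
    rw [resEval_two]
    simp
    ring
  disc_dvd x := by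
    simp only [Fin.prod_univ_four]
    exact Dvd.intro (x 3 * x 5 * (x 4 ^ 2 - 4 * x 3 * x 5)) (by simp; ring)
  J_nonempty k := by fin_cases k <;> simp
  q_update k x t := by fin_cases k <;> simp
  q_bound k x Z h := by
    fin_cases k <;> simp [abs_le] at h ⊢
    · constructor <;> nlinarith [Int.le_self_sq Z]
    · constructor <;> nlinarith [Int.le_self_sq Z]
    · obtain ⟨h3, h4, h5⟩ := h
      constructor <;> nlinarith
    · obtain ⟨h1, h2, h4, h5⟩ := h
      constructor <;> nlinarith
  q_class k i hi x v w p hp h2 hv hw h3 h4 := by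
    have hpp := Nat.prime_iff_prime_int.1 hp
    have h4' := not_dvd_four hp h2
    fin_cases k <;> simp at hi
    · subst hi
      simp at h3 h4
      exact (dvd_sub (h3.mul_left v) (h4.mul_left w)).trans (dvd_of_eq (by ring))
    · subst hi
      simp at h3 h4
      exact (dvd_sub (h3.mul_left v) (h4.mul_left w)).trans (dvd_of_eq (by ring))
    · have hco := hv 4 5 (by decide) (by decide) (by decide)
      have hco' := hv 4 3 (by decide) (by decide) (by decide)
      rcases hi with rfl | rfl | rfl <;> simp at h3 h4 hco hco'
      · refine Prime.dvd_sub_of_dvd_mul_sub (a := 4 * x 5) hpp (fun h => ?_)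
          ((dvd_sub h4 h3).trans (dvd_of_eq (by ring)))
        have h5 := (hpp.dvd_or_dvd h).resolve_left h4'
        refine hco (hpp.dvd_of_dvd_pow (n := 2) ?_) h5
        exact (dvd_add h3 (h5.mul_left (4 * v))).trans (dvd_of_eq (by ring))
      · exact (dvd_sub h3 h4).trans (dvd_of_eq (by ring))
      · refine Prime.dvd_sub_of_dvd_mul_sub (a := 4 * x 3) hpp (fun h => ?_)
          ((dvd_sub h4 h3).trans (dvd_of_eq (by ring)))
        have h5 := (hpp.dvd_or_dvd h).resolve_left h4'
        refine hco' (hpp.dvd_of_dvd_pow (n := 2) ?_) h5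
        exact (dvd_add h3 (h5.mul_left (4 * v))).trans (dvd_of_eq (by ring))
    · have h52 := hv 5 2 (by decide) (by decide) (by decide)
      have h53 := hv 5 3 (by decide) (by decide) (by decide)
      have h30 := hv 3 0 (by decide) (by decide) (by decide)
      have h02 := hv 0 2 (by decide) (by decide) (by decide)
      rcases hi with rfl | rfl | rfl | rfl <;> simp at h3 h4 h52 h53 h30 h02
      · refine Prime.dvd_sub_of_dvd_mul_sub (a := x 5) hpp (fun h => ?_)
          ((dvd_sub h3 h4).trans (dvd_of_eq (by ring)))
        have h5 : (p : ℤ) ∣ x 2 * x 3 :=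
          (dvd_sub (h.mul_left v) h3).trans (dvd_of_eq (by ring))
        exact (hpp.dvd_or_dvd h5).elim (h52 h) (h53 h)
      · refine Prime.dvd_sub_of_dvd_mul_sub (a := x 3) hpp (fun h => ?_)
          ((dvd_sub h4 h3).trans (dvd_of_eq (by ring)))
        have h5 : (p : ℤ) ∣ x 0 * x 5 :=
          (dvd_add (h.mul_left v) h3).trans (dvd_of_eq (by ring))
        exact (hpp.dvd_or_dvd h5).elim (h30 h) (fun h' => h53 h' h)
      · refine Prime.dvd_sub_of_dvd_mul_sub (a := x 2) hpp (fun h => ?_)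
          ((dvd_sub h4 h3).trans (dvd_of_eq (by ring)))
        have h5 : (p : ℤ) ∣ x 0 * x 5 :=
          (dvd_add (h.mul_left v) h3).trans (dvd_of_eq (by ring))
        exact (hpp.dvd_or_dvd h5).elim (fun h' => h02 h' h) (fun h' => h52 h' h)
      · refine Prime.dvd_sub_of_dvd_mul_sub (a := x 0) hpp (fun h => ?_)
          ((dvd_sub h3 h4).trans (dvd_of_eq (by ring)))
        have h5 : (p : ℤ) ∣ x 2 * x 3 :=
          (dvd_sub (h.mul_left v) h3).trans (dvd_of_eq (by ring))
        exact (hpp.dvd_or_dvd h5).elim (h02 h) (fun h' => h30 h' h)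
  singular x v w p hp h2 hx hAD hv hw := by
    have hpp := Nat.prime_iff_prime_int.1 hp
    have hv' := (dvd_pow_self (p : ℤ) two_ne_zero).trans hv
    have hw' := (dvd_pow_self (p : ℤ) two_ne_zero).trans hw
    rw [resEval_two] at hv' hw'
    simp at hv' hw'
    by_cases h5 : (p : ℤ) ∣ x 5
    · have h52 := hx 5 2 (by decide) (by decide) (by decide) h5
      have h53 := hx 5 3 (by decide) (by decide) (by decide) h5
      have h54 := hx 5 4 (by decide) (by decide) (by decide) h5
      have h : (p : ℤ) ∣ x 2 * x 3 * x 4 * (v - w) :=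
        (dvd_sub (h5.mul_right ((v - w) * (x 3 * (v + w) - x 0 * x 4)))
          (dvd_sub hv' hw')).trans (dvd_of_eq (by ring))
      refine (hpp.dvd_or_dvd h).resolve_left fun h => ?_
      exact (hpp.dvd_or_dvd h).elim (fun h => (hpp.dvd_or_dvd h).elim h52 h53) h54
    by_cases h3 : (p : ℤ) ∣ x 3
    · have h30 := hx 3 0 (by decide) (by decide) (by decide) h3
      have h34 := hx 3 4 (by decide) (by decide) (by decide) h3
      have h : (p : ℤ) ∣ x 0 * x 5 * x 4 * (v - w) :=
        (dvd_sub (h3.mul_right ((v - w) * (x 5 * (v + w) - x 2 * x 4)))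
          (dvd_sub hv' hw')).trans (dvd_of_eq (by ring))
      refine (hpp.dvd_or_dvd h).resolve_left fun h => ?_
      exact (hpp.dvd_or_dvd h).elim (fun h => (hpp.dvd_or_dvd h).elim h30 h5) h34
    · have hA : ¬ (p : ℤ) ∣ x 3 * x 5 := fun h => (hpp.dvd_or_dvd h).elim h3 h5
      exact prime_dvd_sub_of_dvd_disc hpp (not_intCast_dvd_two h2) hA
        ((hpp.dvd_or_dvd hAD).resolve_left hA) (hv'.trans (dvd_of_eq (by ring)))
        (hw'.trans (dvd_of_eq (by ring)))

end ResultantFibers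

section Symmetry

variable {ι : Type*} [DecidableEq ι]

lemma tendsto_comp_perm_iterAtTop (σ : Equiv.Perm ι) (n : ι) :
    Tendsto (fun N : ι → ℕ => N ∘ σ) (iterAtTop (σ n)) (iterAtTop n) := by
  intro S hS
  rw [mem_map]
  refine eventually_iterAtTop.2 ?_
  have h := eventually_iterAtTop.1 (show ∀ᶠ N in iterAtTop n, N ∈ S from hS)
  have hσ : Tendsto (fun s : ι → ℕ => s ∘ σ) atTop atTop := by
    refine tendsto_atTop.2 fun b => (eventually_ge_atTop (b ∘ σ.symm)).mono fun s hs i => ?_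
    simpa using hs (σ i)
  filter_upwards [hσ.eventually h] with s hs
  filter_upwards [hs] with T hT
  simpa [Function.update_comp_equiv] using hT

lemma dens_comp_perm [Fintype ι] (σ : Equiv.Perm ι) (N : ι → ℕ) (P : (ι → ℤ) → Prop) :
    dens (N ∘ σ) P = dens N fun x => P (x ∘ σ) := by
  have hsum : ∀ g : (ι → ℤ) → ℝ, ∑ x ∈ cube (N ∘ σ), g x = ∑ x ∈ cube N, g (x ∘ σ) := fun g => by
    refine Finset.sum_nbij' (fun x => x ∘ σ.symm) (fun x => x ∘ σ) ?_ ?_ ?_ ?_ ?_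
    · exact fun x hx => mem_cube.2 fun i => by simpa using mem_cube.1 hx (σ.symm i)
    · exact fun x hx => mem_cube.2 fun i => mem_cube.1 hx (σ i)
    · intro x _; ext i; simp
    · intro x _; ext i; simp
    · intro x _; congr 1; ext i; simp
  have hcard : ((cube (N ∘ σ)).card : ℝ) = (cube N).card := by
    simpa using hsum fun _ => 1
  rw [dens, avg, hsum, hcard]
  rfl

theorem eventually_dens_resEval_le (n : Fin (2 * 2 + 2)) {M : ℕ} (hM : 2 ≤ M) :
    ∀ᶠ N in iterAtTop n, dens N (fun x => LargeSquareDvd M (resEval 2 x)) ≤ 64 / M := by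
  have hM' : (0 : ℝ) < M := by have : 0 < M := by omega
                               positivity
  have h0 : ∀ᶠ N in iterAtTop (0 : Fin (2 * 2 + 2)),
      dens N (fun x => LargeSquareDvd M (resEval 2 x)) ≤ 64 / M := by
    filter_upwards [fiberZero.eventually_dens_largeSquareDvd_le hM] with N hN
    refine hN.trans (div_le_div_of_nonneg_right ?_ hM'.le)
    simp
    norm_num
  have h1 : ∀ᶠ N in iterAtTop (1 : Fin (2 * 2 + 2)),
      dens N (fun x => LargeSquareDvd M (resEval 2 x)) ≤ 64 / M := by
    filter_upwards [fiberOne.eventually_dens_largeSquareDvd_le hM] with N hN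
    refine hN.trans (div_le_div_of_nonneg_right ?_ hM'.le)
    simp
    norm_num
  have hperm (σ : Equiv.Perm (Fin (2 * 2 + 2)))
      (hσ : ∀ x : Fin (2 * 2 + 2) → ℤ, resEval 2 (x ∘ σ) = resEval 2 x) {m m' : Fin (2 * 2 + 2)} (h : σ m = m')
      (hm : ∀ᶠ N in iterAtTop m, dens N (fun x => LargeSquareDvd M (resEval 2 x)) ≤ 64 / M) :
      ∀ᶠ N in iterAtTop m', dens N (fun x => LargeSquareDvd M (resEval 2 x)) ≤ 64 / M := by
    subst h
    filter_upwards [(tendsto_comp_perm_iterAtTop σ m).eventually hm] with N hN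
    rw [dens_comp_perm] at hN
    simpa only [hσ] using hN
  have hswap : ∀ x : Fin (2 * 2 + 2) → ℤ, resEval 2 (x ∘ Equiv.addRight 3) = resEval 2 x :=
    fun x => by
      rw [resEval_two, resEval_two]
      simp [Fin.add_def]
      ring
  have hrev : ∀ x : Fin (2 * 2 + 2) → ℤ,
      resEval 2 (x ∘ (Equiv.swap 0 2 * Equiv.swap 3 5 : Equiv.Perm _)) = resEval 2 x := fun x => by
    have e (i j : Fin (2 * 2 + 2))
        (h : (Equiv.swap 0 2 * Equiv.swap 3 5 : Equiv.Perm (Fin (2 * 2 + 2))) i = j) :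
        (x ∘ (Equiv.swap 0 2 * Equiv.swap 3 5 : Equiv.Perm (Fin (2 * 2 + 2)))) i = x j := by
      rw [← h]; rfl
    rw [resEval_two, resEval_two, e 0 2 (by decide), e 1 1 (by decide), e 2 0 (by decide),
      e 3 5 (by decide), e 4 4 (by decide), e 5 3 (by decide)]
    ring
  have h2 := hperm (m' := 2) _ hrev (by decide) h0
  fin_cases n
  · exact h0
  · exact h1
  · exact h2
  · exact hperm _ hswap (by decide) h0
  · exact hperm _ hswap (by decide) h1
  · exact hperm _ hswap (by decide) h2

end Symmetry

section LocalCount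

open IsLocalRing

section CrossProduct

variable {R : Type*} [CommRing R]

/-- A tuple is primitive if one of its entries is a unit. -/
def Primitive {k : ℕ} (u : Fin k → R) : Prop := ∃ j, IsUnit (u j)

lemma dotProduct_eq_add (v m : Fin 3 → R) (i : Fin 3) :
    v ⬝ᵥ m = v i * m i + i.removeNth v ⬝ᵥ i.removeNth m := by
  simp only [dotProduct, Fin.sum_univ_succAbove _ i, Fin.removeNth_apply]

lemma eq_of_removeNth_eq {α : Type*} {v w : Fin 3 → α} (i : Fin 3) (h : i.removeNth v = i.removeNth w)
    (hi : v i = w i) : v = w := by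
  rw [← Fin.insertNth_self_removeNth i v, ← Fin.insertNth_self_removeNth i w, h, hi]

lemma crossProduct_apply_eq {v w w' : Fin 3 → R} (h : crossProduct v w = crossProduct v w')
    (i k : Fin 3) : v i * w k - v k * w i = v i * w' k - v k * w' i := by
  rw [cross_apply, cross_apply] at h
  have h0 := congr_fun h 0
  have h1 := congr_fun h 1
  have h2 := congr_fun h 2
  simp at h0 h1 h2
  fin_cases i <;> fin_cases k <;> simp <;> first | ring | exact h0 | exact h1 | exact h2 | linear_combination -h0 | linear_combination -h1 | linear_combination -h2

/-- The quadratic form whose value at the cross product of the coefficient vectors of two binary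
quadratic forms is their resultant. -/
def resQuad (m : Fin 3 → R) : R := m 1 ^ 2 - m 0 * m 2

lemma resEval_eq_resQuad (Q : Fin (2 * 2 + 2) → R) :
    resEval 2 Q = resQuad (crossProduct ![Q 0, Q 1, Q 2] ![Q 3, Q 4, Q 5]) := by
  rw [resEval_two, resQuad, cross_apply]
  simp
  ring

variable [Fintype R]

open Classical in
lemma card_crossProduct_fiber_le (v m : Fin 3 → R) (hv : Primitive v) :
    (Finset.univ.filter fun w : Fin 3 → R => crossProduct v w = m).card ≤ Fintype.card R := by
  obtain ⟨i, hi⟩ := hv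
  refine Finset.card_le_card_of_injOn (fun w => w i) (fun _ _ => Finset.mem_coe.2
    (Finset.mem_univ _)) fun w hw w' hw' h => ?_
  have e := (Finset.mem_filter.1 hw).2.trans (Finset.mem_filter.1 hw').2.symm
  ext k
  refine hi.mul_left_cancel ?_
  have h1 := crossProduct_apply_eq e i k
  simp only at h
  rw [h] at h1
  exact sub_left_inj.1 h1

open Classical in
lemma card_resQuad_crossProduct_le (v : Fin 3 → R) (hv : Primitive v) :
    (Finset.univ.filter fun w : Fin 3 → R => resQuad (crossProduct v w) = 0).card ≤
      Fintype.card R * (Finset.univ.filter fun m : Fin 3 → R => v ⬝ᵥ m = 0 ∧ resQuad m = 0).card := by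
  refine Finset.card_le_mul_card_image_of_maps_to (f := fun w => crossProduct v w)
    (fun w hw => ?_) _ fun m _ => ?_
  · exact Finset.mem_filter.2 ⟨Finset.mem_univ _, dot_self_cross v w, (Finset.mem_filter.1 hw).2⟩
  · exact (Finset.card_le_card fun w hw => Finset.mem_filter.2 ⟨Finset.mem_univ _,
      (Finset.mem_filter.1 hw).2⟩).trans (card_crossProduct_fiber_le v m hv)

end CrossProduct

variable {R : Type*} [CommRing R] [IsLocalRing R]

lemma not_primitive_iff {k : ℕ} {u : Fin k → R} : ¬ Primitive u ↔ ∀ j, u j ∈ maximalIdeal R := by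
  simp [Primitive, mem_maximalIdeal]

lemma isUnit_of_notMem_maximalIdeal {x : R} (h : x ∉ maximalIdeal R) : IsUnit x := by
  simpa using h

variable [Fintype R] {p : ℕ}

open Classical in
lemma card_primitive (hR : Fintype.card R = p ^ 2) (hm : Nat.card (maximalIdeal R) = p) (k : ℕ) :
    (Finset.univ.filter fun u : Fin k → R => ¬ Primitive u).card = p ^ k ∧
    ((Finset.univ.filter fun u : Fin k → R => Primitive u).card : ℤ) = p ^ (2 * k) - p ^ k := by
  have h1 : (Finset.univ.filter fun u : Fin k → R => ¬ Primitive u).card = p ^ k := by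
    have : (Finset.univ.filter fun u : Fin k → R => ¬ Primitive u) =
        Fintype.piFinset fun _ => Finset.univ.filter fun x : R => x ∈ maximalIdeal R := by
      ext u
      simp only [Finset.mem_filter, Finset.mem_univ, true_and, Fintype.mem_piFinset,
        not_primitive_iff]
    rw [this, Fintype.card_piFinset, Finset.prod_const, Finset.card_univ, Fintype.card_fin,
      ← Fintype.card_subtype, ← Nat.card_eq_fintype_card]
    congr
  refine ⟨h1, ?_⟩
  have h2 := Finset.card_filter_add_card_filter_not (s := (Finset.univ : Finset (Fin k → R)))
    fun u => Primitive u
  rw [h1, Finset.card_univ, Fintype.card_fun, hR, Fintype.card_fin, ← pow_mul] at h2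
  rw [← Nat.cast_pow, ← h2]
  push_cast
  ring

open Classical in
lemma card_orthogonal_le {m : Fin 3 → R} (hmp : Primitive m) :
    (Finset.univ.filter fun v : Fin 3 → R => Primitive v ∧ v ⬝ᵥ m = 0).card ≤
      (Finset.univ.filter fun u : Fin 2 → R => Primitive u).card := by
  obtain ⟨i, hi⟩ := hmp
  refine Finset.card_le_card_of_injOn (fun v => i.removeNth v) (fun v hv => ?_) ?_
  · obtain ⟨hv, h0⟩ := (Finset.mem_filter.1 hv).2
    refine Finset.mem_coe.2 (Finset.mem_filter.2 ⟨Finset.mem_univ _, ?_⟩)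
    by_contra h
    rw [not_primitive_iff] at h
    rw [dotProduct_eq_add v m i] at h0
    have h1 : v i * m i ∈ maximalIdeal R := by
      rw [eq_neg_of_add_eq_zero_left h0]
      exact neg_mem (Ideal.sum_mem _ fun j _ => Ideal.mul_mem_right _ _ (h j))
    have h2 : v i ∈ maximalIdeal R := by
      simpa [Ideal.mul_unit_mem_iff_mem _ hi] using h1
    obtain ⟨j, hj⟩ := hv
    rcases Fin.eq_self_or_eq_succAbove i j with rfl | ⟨l, rfl⟩
    · exact (mem_maximalIdeal _).1 h2 hj
    · exact (mem_maximalIdeal _).1 (h l) hj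
  · intro v hv w hw h
    have hv0 := (Finset.mem_filter.1 hv).2.2
    have hw0 := (Finset.mem_filter.1 hw).2.2
    refine eq_of_removeNth_eq i h (hi.mul_right_cancel ?_)
    rw [dotProduct_eq_add v m i] at hv0
    rw [dotProduct_eq_add w m i, ← show i.removeNth v = i.removeNth w from h] at hw0
    linear_combination hv0 - hw0

open Classical in
lemma card_orthogonal_nonprimitive_le (hm : Nat.card (maximalIdeal R) = p) {m : Fin 3 → R}
    (hsq : ∀ x ∈ maximalIdeal R, ∀ y ∈ maximalIdeal R, x * y = 0)
    (hmp : ¬ Primitive m) (hm0 : m ≠ 0) :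
    (Finset.univ.filter fun v : Fin 3 → R => Primitive v ∧ v ⬝ᵥ m = 0).card ≤
      p * (Finset.univ.filter fun u : Fin 2 → R => Primitive u).card := by
  obtain ⟨i, hi⟩ := Function.ne_iff.1 hm0
  rw [not_primitive_iff] at hmp
  have hann {x : R} (hx : x * m i = 0) : x ∈ maximalIdeal R := by
    by_contra h
    exact hi ((isUnit_of_notMem_maximalIdeal h).mul_left_cancel (by simpa using hx))
  refine Finset.card_le_mul_card_image_of_maps_to (f := fun v => i.removeNth v) (fun v hv => ?_) _
    fun u _ => ?_
  · obtain ⟨hv, h0⟩ := (Finset.mem_filter.1 hv).2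
    refine Finset.mem_filter.2 ⟨Finset.mem_univ _, ?_⟩
    by_contra h
    rw [not_primitive_iff] at h
    rw [dotProduct_eq_add v m i] at h0
    have h1 : i.removeNth v ⬝ᵥ i.removeNth m = 0 :=
      Finset.sum_eq_zero fun j _ => hsq _ (h j) _ (hmp _)
    rw [h1, add_zero] at h0
    obtain ⟨j, hj⟩ := hv
    rcases Fin.eq_self_or_eq_succAbove i j with rfl | ⟨l, rfl⟩
    · exact (mem_maximalIdeal _).1 (hann h0) hj
    · exact (mem_maximalIdeal _).1 (h l) hj
  · set S := (Finset.univ.filter fun v : Fin 3 → R => Primitive v ∧ v ⬝ᵥ m = 0).filter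
      fun v => i.removeNth v = u with hS
    rcases S.eq_empty_or_nonempty with h | ⟨w, hw⟩
    · simp [h]
    have hmem {v : Fin 3 → R} (hv : v ∈ S) : v i * m i + u ⬝ᵥ i.removeNth m = 0 ∧
        i.removeNth v = u := by
      have h1 := Finset.mem_filter.1 hv
      have h2 := (Finset.mem_filter.1 h1.1).2.2
      rw [dotProduct_eq_add v m i, h1.2] at h2
      exact ⟨h2, h1.2⟩
    have hcard : (Finset.univ.filter fun x : R => x ∈ maximalIdeal R).card = p := by
      rw [← Fintype.card_subtype, ← Nat.card_eq_fintype_card, ← hm]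
    rw [← hcard]
    refine Finset.card_le_card_of_injOn (fun v => v i - w i) (fun v hv => ?_) ?_
    · refine Finset.mem_coe.2 (Finset.mem_filter.2 ⟨Finset.mem_univ _, hann ?_⟩)
      linear_combination (hmem hv).1 - (hmem hw).1
    · intro v hv v' hv' h
      exact eq_of_removeNth_eq i ((hmem hv).2.trans (hmem hv').2.symm) (sub_left_inj.1 h)

open Classical in
lemma card_resQuad_eq_zero_le
    (hsq : ∀ x ∈ maximalIdeal R, ∀ y ∈ maximalIdeal R, x * y = 0) :
    (Finset.univ.filter fun m : Fin 3 → R => Primitive m ∧ resQuad m = 0).card ≤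
      (Finset.univ.filter fun u : Fin 2 → R => Primitive u).card := by
  have key {m : Fin 3 → R} (hm : Primitive m) (h0 : resQuad m = 0) (h : ¬ IsUnit (m 0)) :
      m 0 = 0 ∧ ¬ IsUnit (m 1) ∧ IsUnit (m 2) := by
    rw [resQuad, sub_eq_zero] at h0
    have h1 : m 1 ∈ maximalIdeal R := by
      refine (maximalIdeal.isMaximal R).isPrime.mem_of_pow_mem 2 ?_
      rw [h0]
      exact Ideal.mul_mem_right _ _ h
    have h2 : IsUnit (m 2) := by
      obtain ⟨j, hj⟩ := hm
      fin_cases j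
      · exact (h hj).elim
      · exact (h1 hj).elim
      · exact hj
    rw [sq, hsq _ h1 _ h1] at h0
    exact ⟨h2.mul_right_cancel (by rw [← h0, zero_mul]), h1, h2⟩
  refine Finset.card_le_card_of_injOn
    (fun m => if IsUnit (m 0) then ![m 0, m 1] else ![m 1, m 2]) (fun m hm => ?_) ?_
  · obtain ⟨h1, h2⟩ := (Finset.mem_filter.1 hm).2
    refine Finset.mem_coe.2 (Finset.mem_filter.2 ⟨Finset.mem_univ _, ?_⟩)
    by_cases h : IsUnit (m 0)
    · exact ⟨0, by simp [h]⟩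
    · exact ⟨1, by simpa [h] using (key h1 h2 h).2.2⟩
  · intro m hm m' hm' h
    obtain ⟨h1, h2⟩ := (Finset.mem_filter.1 hm).2
    obtain ⟨h1', h2'⟩ := (Finset.mem_filter.1 hm').2
    by_cases hu : IsUnit (m 0) <;> by_cases hu' : IsUnit (m' 0) <;>
      simp [hu, hu'] at h
    · obtain ⟨e0, e1⟩ := h
      rw [resQuad] at h2 h2'
      rw [← e0, ← e1] at h2'
      have e2 : m 2 = m' 2 := hu.mul_left_cancel (by linear_combination h2' - h2)
      ext j; fin_cases j
      exacts [e0, e1, e2]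
    · exact ((key h1' h2' hu').2.1 (h.1 ▸ hu)).elim
    · exact ((key h1 h2 hu).2.1 (h.1 ▸ hu')).elim
    · ext j; fin_cases j
      exacts [(key h1 h2 hu).1.trans (key h1' h2' hu').1.symm, h.1, h.2]

open Classical in
lemma sum_card_orthogonal_le (hR : Fintype.card R = p ^ 2) (hm : Nat.card (maximalIdeal R) = p)
    (hsq : ∀ x ∈ maximalIdeal R, ∀ y ∈ maximalIdeal R, x * y = 0) :
    (∑ v : Fin 3 → R with Primitive v,
      ((Finset.univ.filter fun m : Fin 3 → R => v ⬝ᵥ m = 0 ∧ resQuad m = 0).card : ℤ)) ≤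
      (p ^ 4 - p ^ 2) ^ 2 + (p ^ 3 - 1) * (p * (p ^ 4 - p ^ 2)) + (p ^ 6 - p ^ 3) := by
  set P : Finset (Fin 3 → R) := Finset.univ.filter fun v => Primitive v with hP
  set Z : Finset (Fin 3 → R) := Finset.univ.filter fun m => ¬ Primitive m with hZ
  set f : (Fin 3 → R) → ℤ := fun m =>
    ((Finset.univ.filter fun v : Fin 3 → R => Primitive v ∧ v ⬝ᵥ m = 0).card : ℤ) with hf
  obtain ⟨-, hc2⟩ := card_primitive hR hm 2
  obtain ⟨hz3, hc3⟩ := card_primitive hR hm 3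
  have h0 : (0 : Fin 3 → R) ∈ Z := Finset.mem_filter.2 ⟨Finset.mem_univ _,
    not_primitive_iff.2 fun j => zero_mem _⟩
  have hswap : ∑ v ∈ P, ((Finset.univ.filter fun m : Fin 3 → R =>
      v ⬝ᵥ m = 0 ∧ resQuad m = 0).card : ℤ) =
      ∑ m : Fin 3 → R with resQuad m = 0, f m := by
    have h1 := Finset.sum_card_bipartiteAbove_eq_sum_card_bipartiteBelow (s := P)
      (t := Finset.univ.filter fun m : Fin 3 → R => resQuad m = 0) fun v m => v ⬝ᵥ m = 0
    simp only [Finset.bipartiteAbove, Finset.bipartiteBelow, Finset.filter_filter, hP] at h1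
    simp only [hf, hP, ← Nat.cast_sum, ← h1, and_comm]
  have hprim : ∑ m : Fin 3 → R with Primitive m ∧ resQuad m = 0, f m ≤ (p ^ 4 - p ^ 2) ^ 2 := by
    have h1 : ((Finset.univ.filter fun m : Fin 3 → R => Primitive m ∧ resQuad m = 0).card : ℤ) ≤
        p ^ 4 - p ^ 2 := (Int.ofNat_le.2 (card_resQuad_eq_zero_le hsq)).trans_eq hc2
    have h2 : ∀ m ∈ Finset.univ.filter fun m : Fin 3 → R => Primitive m ∧ resQuad m = 0,
        f m ≤ p ^ 4 - p ^ 2 := fun m hm' =>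
      (Int.ofNat_le.2 (card_orthogonal_le (Finset.mem_filter.1 hm').2.1)).trans_eq hc2
    refine (Finset.sum_le_card_nsmul _ _ _ h2).trans ?_
    rw [nsmul_eq_mul, sq (_ - _)]
    exact mul_le_mul_of_nonneg_right h1 ((Int.natCast_nonneg _).trans h1)
  have hnon : ∑ m ∈ Z.erase 0, f m ≤ (p ^ 3 - 1) * (p * (p ^ 4 - p ^ 2)) := by
    have h2 : ∀ m ∈ Z.erase 0, f m ≤ p * (p ^ 4 - p ^ 2) := fun m hm' => by
      have h3 := Finset.mem_erase.1 hm'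
      refine (Int.ofNat_le.2 (card_orthogonal_nonprimitive_le hm hsq
        (Finset.mem_filter.1 h3.2).2 h3.1)).trans_eq ?_
      push_cast
      rw [hc2]
    refine (Finset.sum_le_card_nsmul _ _ _ h2).trans_eq ?_
    have h3 := Finset.card_erase_add_one h0
    rw [hz3] at h3
    have h4 : ((Z.erase 0).card : ℤ) = p ^ 3 - 1 := by
      rw [eq_sub_iff_add_eq]; exact_mod_cast h3
    rw [nsmul_eq_mul, h4]
  have hzero : f 0 = p ^ 6 - p ^ 3 := by
    simp only [hf, dotProduct_zero, and_true]
    exact hc3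
  have hnn (m : Fin 3 → R) : 0 ≤ f m := Int.natCast_nonneg _
  rw [hswap]
  calc ∑ m : Fin 3 → R with resQuad m = 0, f m
      = ∑ m : Fin 3 → R with Primitive m ∧ resQuad m = 0, f m +
        ∑ m : Fin 3 → R with ¬ Primitive m ∧ resQuad m = 0, f m := by
        rw [← Finset.sum_filter_add_sum_filter_not _ (fun m => Primitive m),
          Finset.filter_filter, Finset.filter_filter]
        simp only [and_comm]
    _ ≤ ∑ m : Fin 3 → R with Primitive m ∧ resQuad m = 0, f m + ∑ m ∈ Z, f m := by
        refine add_le_add le_rfl (Finset.sum_le_sum_of_subset_of_nonneg (fun m hm' => ?_)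
          fun m _ _ => hnn m)
        exact Finset.mem_filter.2 ⟨Finset.mem_univ _, (Finset.mem_filter.1 hm').2.1⟩
    _ = ∑ m : Fin 3 → R with Primitive m ∧ resQuad m = 0, f m +
        (∑ m ∈ Z.erase 0, f m + f 0) := by rw [Finset.sum_erase_add _ _ h0]
    _ ≤ _ := by rw [hzero]; linarith

open Classical in
lemma card_pairs_resQuad_le (hR : Fintype.card R = p ^ 2) (hm : Nat.card (maximalIdeal R) = p)
    (hsq : ∀ x ∈ maximalIdeal R, ∀ y ∈ maximalIdeal R, x * y = 0) :
    (∑ v : Fin 3 → R, ((Finset.univ.filter fun w : Fin 3 → R =>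
      resQuad (crossProduct v w) = 0).card : ℤ)) ≤
      p ^ 12 - (p ^ 12 - 2 * p ^ 10 - p ^ 9 + 2 * p ^ 8 + p ^ 7 - p ^ 6) := by
  rw [← Finset.sum_filter_add_sum_filter_not _ (fun v : Fin 3 → R => Primitive v)]
  have h1 : ∑ v : Fin 3 → R with Primitive v, ((Finset.univ.filter fun w : Fin 3 → R =>
      resQuad (crossProduct v w) = 0).card : ℤ) ≤ p ^ 2 * ((p ^ 4 - p ^ 2) ^ 2 +
      (p ^ 3 - 1) * (p * (p ^ 4 - p ^ 2)) + (p ^ 6 - p ^ 3)) := by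
    refine le_trans (Finset.sum_le_sum fun v hv => Int.ofNat_le.2
      (card_resQuad_crossProduct_le v (Finset.mem_filter.1 hv).2)) ?_
    rw [hR]
    push_cast
    rw [← Finset.mul_sum]
    exact mul_le_mul_of_nonneg_left (sum_card_orthogonal_le hR hm hsq) (by positivity)
  have h2 : ∑ v : Fin 3 → R with ¬ Primitive v, ((Finset.univ.filter fun w : Fin 3 → R =>
      resQuad (crossProduct v w) = 0).card : ℤ) ≤ p ^ 3 * p ^ 6 := by
    refine (Finset.sum_le_card_nsmul _ _ (p ^ 6 : ℤ) fun v _ => ?_).trans_eq ?_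
    · refine (Int.ofNat_le.2 (Finset.card_le_univ _)).trans_eq ?_
      rw [Fintype.card_fun, hR, Fintype.card_fin]
      push_cast
      ring
    · rw [(card_primitive hR hm 3).1, nsmul_eq_mul]
      push_cast
      rfl
  refine (add_le_add h1 h2).trans_eq ?_
  ring

end LocalCount

section ResDensity

open IsLocalRing

variable {p : ℕ}

lemma ZMod.not_isUnit_iff_dvd_val (hp : p.Prime) (x : ZMod (p ^ 2)) :
    ¬ IsUnit x ↔ p ∣ x.val := by
  have : NeZero p := ⟨hp.ne_zero⟩
  conv_lhs => rw [← ZMod.natCast_zmod_val x]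
  rw [ZMod.isUnit_natCast_iff_not_dvd_pow hp two_pos, not_not]

lemma ZMod.isLocalRing_sq (hp : p.Prime) : IsLocalRing (ZMod (p ^ 2)) := by
  have : NeZero p := ⟨hp.ne_zero⟩
  have : Fact (1 < p ^ 2) := ⟨Nat.one_lt_pow two_ne_zero hp.one_lt⟩
  refine IsLocalRing.of_nonunits_add fun a b ha hb => ?_
  rw [mem_nonunits_iff, ZMod.not_isUnit_iff_dvd_val hp] at *
  rw [ZMod.val_add]
  exact (Nat.dvd_mod_iff (dvd_pow_self p two_ne_zero)).2 (dvd_add ha hb)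

lemma ZMod.mul_eq_zero_of_not_isUnit (hp : p.Prime) {x y : ZMod (p ^ 2)} (hx : ¬ IsUnit x)
    (hy : ¬ IsUnit y) : x * y = 0 := by
  have : NeZero p := ⟨hp.ne_zero⟩
  rw [ZMod.not_isUnit_iff_dvd_val hp] at hx hy
  rw [← ZMod.natCast_zmod_val x, ← ZMod.natCast_zmod_val y, ← Nat.cast_mul,
    ZMod.natCast_eq_zero_iff]
  exact (dvd_of_eq (sq p)).trans (mul_dvd_mul hx hy)

lemma ZMod.card_not_isUnit (hp : p.Prime) : Nat.card {x : ZMod (p ^ 2) // ¬ IsUnit x} = p := by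
  classical
  have : NeZero p := ⟨hp.ne_zero⟩
  have h1 := Fintype.card_subtype_compl fun x : ZMod (p ^ 2) => IsUnit x
  have h2 : Fintype.card {x : ZMod (p ^ 2) // IsUnit x} = p * (p - 1) := by
    rw [← Fintype.card_congr (Equiv.ofBijective
      (fun u : (ZMod (p ^ 2))ˣ => (⟨u, u.isUnit⟩ : {x : ZMod (p ^ 2) // IsUnit x}))
      ⟨fun _ _ h => Units.ext (congrArg Subtype.val h), fun x => ⟨x.2.unit, rfl⟩⟩), ZMod.card_units_eq_totient,
      Nat.totient_prime_pow hp two_pos]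
    simp
  rw [ZMod.card, h2] at h1
  rw [Nat.card_eq_fintype_card, h1, Nat.mul_sub, mul_one, sq]
  exact Nat.sub_sub_self (Nat.le_mul_self p)

/-- The proportion of the residue classes modulo `p ^ 2` at which the resultant of two binary
quadratic forms does not vanish. -/
def resDensity (p : ℕ) : ℝ :=
  Nat.card {Q : Fin (2 * 2 + 2) → ZMod (p ^ 2) | resEval 2 Q ≠ 0} /
    ((p ^ 2 : ℕ) : ℝ) ^ Fintype.card (Fin (2 * 2 + 2))

lemma resDensity_nonneg (p : ℕ) : 0 ≤ resDensity p := by unfold resDensity; positivity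

lemma resDensity_le_one (p : ℕ) (hp : p ≠ 0) : resDensity p ≤ 1 := by
  have : NeZero p := ⟨hp⟩
  refine div_le_one_of_le₀ ?_ (by positivity)
  have h := Nat.card_le_card_of_injective
    (fun Q : {Q : Fin (2 * 2 + 2) → ZMod (p ^ 2) | resEval 2 Q ≠ 0} => Q.1)
    Subtype.val_injective
  rw [Nat.card_fun, Nat.card_zmod, Nat.card_eq_fintype_card (α := Fin _)] at h
  exact_mod_cast h

lemma le_card_resEval_ne_zero (hp : p.Prime) :
    (p ^ 12 - 2 * p ^ 10 - p ^ 9 + 2 * p ^ 8 + p ^ 7 - p ^ 6 : ℤ) ≤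
      Nat.card {Q : Fin (2 * 2 + 2) → ZMod (p ^ 2) | resEval 2 Q ≠ 0} := by
  classical
  have : NeZero p := ⟨hp.ne_zero⟩
  have := ZMod.isLocalRing_sq hp
  have key := card_pairs_resQuad_le (R := ZMod (p ^ 2)) (p := p) (ZMod.card _)
    (ZMod.card_not_isUnit hp) fun x hx y hy => ZMod.mul_eq_zero_of_not_isUnit hp hx hy
  have h1 : ((Finset.univ.filter fun Q : Fin (2 * 2 + 2) → ZMod (p ^ 2) => resEval 2 Q = 0).card : ℤ)
      ≤ ∑ v : Fin 3 → ZMod (p ^ 2), ((Finset.univ.filter fun w : Fin 3 → ZMod (p ^ 2) =>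
      resQuad (crossProduct v w) = 0).card : ℤ) := by
    rw [← Nat.cast_sum, ← Finset.card_sigma]
    refine Int.ofNat_le.2 (Finset.card_le_card_of_injOn
      (fun Q => ⟨![Q 0, Q 1, Q 2], ![Q 3, Q 4, Q 5]⟩) (fun Q hQ => ?_) fun Q _ Q' _ h => ?_)
    · have := (Finset.mem_filter.1 hQ).2
      rw [resEval_eq_resQuad] at this
      exact Finset.mem_coe.2 (Finset.mem_sigma.2 ⟨Finset.mem_univ _,
        Finset.mem_filter.2 ⟨Finset.mem_univ _, this⟩⟩)
    · simp at h
      ext i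
      fin_cases i <;> simp [h]
  have h2 := Finset.card_filter_add_card_filter_not
    (s := (Finset.univ : Finset (Fin (2 * 2 + 2) → ZMod (p ^ 2)))) fun Q => resEval 2 Q = 0
  rw [Finset.card_univ, Fintype.card_fun, ZMod.card, Fintype.card_fin] at h2
  have h3 : Nat.card {Q : Fin (2 * 2 + 2) → ZMod (p ^ 2) | resEval 2 Q ≠ 0} =
      (Finset.univ.filter fun Q : Fin (2 * 2 + 2) → ZMod (p ^ 2) => ¬ resEval 2 Q = 0).card := by
    rw [Nat.card_eq_fintype_card, Fintype.card_ofFinset]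
    rfl
  have h4 := congrArg (Nat.cast : ℕ → ℤ) h2
  push_cast at h4
  rw [h3]
  have h5 : ((p : ℤ) ^ 2) ^ (2 * 2 + 2) = p ^ 12 := by ring
  rw [h5] at h4
  have h6 := h1.trans (le_of_eq_of_le (by congr!) key)
  linarith

lemma le_resDensity (hp : p.Prime) :
    1 - 2 / (p : ℝ) ^ 2 - 1 / (p : ℝ) ^ 3 + 2 / (p : ℝ) ^ 4 + 1 / (p : ℝ) ^ 5 - 1 / (p : ℝ) ^ 6 ≤
      resDensity p := by
  have hp0 : (0 : ℝ) < p := by exact_mod_cast hp.pos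
  have h := (Int.cast_le (R := ℝ)).2 (le_card_resEval_ne_zero hp)
  push_cast at h
  have e : ((p ^ 2 : ℕ) : ℝ) ^ Fintype.card (Fin (2 * 2 + 2)) = (p : ℝ) ^ 12 := by
    rw [Fintype.card_fin]; push_cast; ring
  rw [resDensity, e, le_div_iff₀ (by positivity)]
  refine le_trans (le_of_eq ?_) h
  field_simp

end ResDensity

section EulerProduct

/-- The proportion of the nonzero vectors of length six modulo `p`. -/
def primDensity (p : ℕ) : ℝ := 1 - 1 / (p : ℝ) ^ 6

lemma one_div_prime_pow_le {p : ℕ} (hp : p.Prime) (k : ℕ) : 1 / (p : ℝ) ^ k ≤ (1 / 2) ^ k := by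
  rw [one_div, ← inv_pow]
  have : (2 : ℝ) ≤ p := by exact_mod_cast hp.two_le
  refine pow_le_pow_left₀ (by positivity) ?_ k
  rw [one_div]
  exact inv_anti₀ two_pos this

lemma one_sub_prime_pow_pos {p : ℕ} (hp : p.Prime) {k : ℕ} (hk : k ≠ 0) :
    0 < 1 - 1 / (p : ℝ) ^ k := by
  have h1 := one_div_prime_pow_le hp k
  have h2 : (1 / 2 : ℝ) ^ k < 1 := pow_lt_one₀ (by norm_num) (by norm_num) hk
  linarith

lemma primDensity_pos {p : ℕ} (hp : p.Prime) : 0 < primDensity p :=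
  one_sub_prime_pow_pos hp (by norm_num)

lemma primDensity_le_one (p : ℕ) : primDensity p ≤ 1 := sub_le_self _ (by positivity)

lemma antitone_prod_primesBelow {f : ℕ → ℝ} (h0 : ∀ p, p.Prime → 0 ≤ f p)
    (h1 : ∀ p, p.Prime → f p ≤ 1) : Antitone fun M : ℕ => ∏ p ∈ M.primesBelow, f p :=
  fun _ _ h => Finset.prod_le_prod_of_subset_of_le_one (Nat.primesBelow_mono h)
    (fun _ hp => h0 _ (Nat.prime_of_mem_primesBelow hp))
    fun _ hp _ => h1 _ (Nat.prime_of_mem_primesBelow hp)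

/-- The completely multiplicative function `n ↦ 1 / n ^ 2`. -/
def invSqHom : ℕ →*₀ ℝ where
  toFun n := 1 / (n : ℝ) ^ 2
  map_zero' := by simp
  map_one' := by simp
  map_mul' m n := by push_cast; rw [mul_pow, one_div_mul_one_div]

lemma six_div_pi_sq_le_prod (M : ℕ) :
    6 / Real.pi ^ 2 ≤ ∏ p ∈ M.primesBelow, (1 - 1 / (p : ℝ) ^ 2) := by
  have hsum : Summable (‖invSqHom ·‖) := by
    refine hasSum_zeta_two.summable.congr fun n => (Real.norm_of_nonneg ?_).symm
    exact one_div_nonneg.2 (sq_nonneg _)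
  have hlim := EulerProduct.eulerProduct_completely_multiplicative hsum
  have hval : ∑' n, invSqHom n = Real.pi ^ 2 / 6 := hasSum_zeta_two.tsum_eq
  rw [hval] at hlim
  have hlim' := hlim.inv₀ (by positivity)
  rw [inv_div] at hlim'
  refine Antitone.le_of_tendsto (f := fun M : ℕ => ∏ p ∈ M.primesBelow, (1 - 1 / (p : ℝ) ^ 2)) ?_
    (hlim'.congr fun M => ?_) M
  · exact antitone_prod_primesBelow (fun p hp => (one_sub_prime_pow_pos hp two_ne_zero).le)
      fun p _ => sub_le_self _ (by positivity)
  · rw [Finset.prod_inv_distrib, inv_inv]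
    rfl

lemma le_prod_one_sub_inv_cube {M : ℕ} (hM : 11 ≤ M) :
    1 - 1 / 220 + 1 / (2 * ((M : ℝ) - 1) * M) ≤
      ∏ p ∈ M.primesBelow with 11 ≤ p, (1 - 1 / (p : ℝ) ^ 3) := by
  induction M, hM using Nat.le_induction with
  | base =>
    rw [show (Nat.primesBelow 11).filter (11 ≤ ·) = ∅ by decide]
    norm_num
  | succ M hM ih =>
    have hM' : (11 : ℝ) ≤ M := by exact_mod_cast hM
    have hstep : 1 / (2 * ((M : ℝ) - 1) * M) - 1 / (2 * (((M + 1 : ℕ) : ℝ) - 1) * (M + 1 : ℕ)) =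
        1 / ((M - 1) * M * (M + 1)) := by
      have : (M : ℝ) - 1 ≠ 0 := by linarith
      push_cast
      rw [add_sub_cancel_right]
      field_simp
      ring
    have hcube : 1 / (M : ℝ) ^ 3 ≤ 1 / ((M - 1) * M * (M + 1)) :=
      one_div_le_one_div_of_le
        (mul_pos (mul_pos (by linarith) (by linarith)) (by linarith)) (by nlinarith)
    rw [Nat.primesBelow_succ]
    split_ifs with hp
    · rw [Finset.filter_insert, if_pos hM, Finset.prod_insert (by simp [Nat.mem_primesBelow])]
      have h1 : ∏ p ∈ M.primesBelow with 11 ≤ p, (1 - 1 / (p : ℝ) ^ 3) ≤ 1 :=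
        Finset.prod_le_one (fun p h => (one_sub_prime_pow_pos (Nat.prime_of_mem_primesBelow
          (Finset.mem_filter.1 h).1) (by norm_num)).le) fun p _ => sub_le_self _ (by positivity)
      have h2 : 0 ≤ 1 / (M : ℝ) ^ 3 := by positivity
      nlinarith
    · have h2 : 0 ≤ 1 / (M : ℝ) ^ 3 := by positivity
      linarith

/-- The lower bound for `resDensity p` coming from the local count. -/
def resDensityBound (p : ℕ) : ℝ :=
  1 - 2 / (p : ℝ) ^ 2 - 1 / (p : ℝ) ^ 3 + 2 / (p : ℝ) ^ 4 + 1 / (p : ℝ) ^ 5 - 1 / (p : ℝ) ^ 6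

/-- The Euler factor left after comparing `resDensity p` with the factors of `ζ(6) / ζ(2) ^ 2`. -/
def auxFactor (p : ℕ) : ℝ :=
  if 11 ≤ p then 1 - 1 / (p : ℝ) ^ 3 else
    resDensityBound p / ((1 - 1 / (p : ℝ) ^ 2) ^ 2 * primDensity p)

lemma auxFactor_nonneg {p : ℕ} (hp : p.Prime) : 0 ≤ auxFactor p := by
  unfold auxFactor
  split_ifs with h
  · exact (one_sub_prime_pow_pos hp (by norm_num)).le
  · refine div_nonneg ?_ (mul_nonneg (sq_nonneg _) (primDensity_pos hp).le)
    have hp' : p ∈ Nat.primesBelow 11 := Nat.mem_primesBelow.2 ⟨by omega, hp⟩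
    rw [show Nat.primesBelow 11 = {2, 3, 5, 7} by decide] at hp'
    simp only [Finset.mem_insert, Finset.mem_singleton] at hp'
    unfold resDensityBound
    rcases hp' with rfl | rfl | rfl | rfl <;> norm_num

lemma auxFactor_mul_le {p : ℕ} (hp : p.Prime) :
    auxFactor p * (1 - 1 / (p : ℝ) ^ 2) ^ 2 * primDensity p ≤ resDensity p := by
  refine le_trans ?_ (le_resDensity hp)
  change _ ≤ resDensityBound p
  have hu := one_sub_prime_pow_pos hp two_ne_zero
  have hq := primDensity_pos hp
  unfold auxFactor
  split_ifs with h
  · have hx : 0 ≤ 1 - 1 / (p : ℝ) := by simpa using (one_sub_prime_pow_pos hp one_ne_zero).le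
    have h3 := one_sub_prime_pow_pos hp three_ne_zero
    refine (mul_le_of_le_one_right (mul_nonneg h3.le (sq_nonneg _)) (primDensity_le_one p)).trans ?_
    have : 0 ≤ (1 / (p : ℝ)) ^ 4 * (1 - 1 / (p : ℝ)) * (1 - 1 / (p : ℝ) ^ 2) := by positivity
    refine le_of_sub_nonneg (this.trans_eq ?_)
    unfold resDensityBound
    ring
  · rw [mul_assoc, div_mul_cancel₀ _ (mul_pos (pow_pos hu 2) hq).ne']

lemma le_prod_auxFactor {M : ℕ} (hM : 11 ≤ M) :
    0.89 ≤ ∏ p ∈ M.primesBelow, auxFactor p := by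
  rw [← Finset.prod_filter_mul_prod_filter_not _ (11 ≤ ·)]
  have h1 : ∏ p ∈ M.primesBelow with ¬ 11 ≤ p, auxFactor p = ∏ p ∈ {2, 3, 5, 7}, auxFactor p := by
    refine Finset.prod_congr ?_ fun _ _ => rfl
    rw [← show Nat.primesBelow 11 = {2, 3, 5, 7} by decide]
    ext p
    simp only [Finset.mem_filter, Nat.mem_primesBelow]
    constructor
    · rintro ⟨⟨-, h⟩, h'⟩; exact ⟨by omega, h⟩
    · rintro ⟨h, h'⟩; exact ⟨⟨by omega, h'⟩, by omega⟩
  have h2 : ∏ p ∈ M.primesBelow with 11 ≤ p, auxFactor p =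
      ∏ p ∈ M.primesBelow with 11 ≤ p, (1 - 1 / (p : ℝ) ^ 3) :=
    Finset.prod_congr rfl fun p hp => if_pos (Finset.mem_filter.1 hp).2
  have h3 : (1 - 1 / 220 : ℝ) ≤ ∏ p ∈ M.primesBelow with 11 ≤ p, (1 - 1 / (p : ℝ) ^ 3) := by
    have hM' : (11 : ℝ) ≤ M := by exact_mod_cast hM
    have : 0 < 2 * ((M : ℝ) - 1) * M := mul_pos (by linarith) (by linarith)
    have := one_div_pos.2 this
    linarith [le_prod_one_sub_inv_cube hM]
  have h4 : (0.895 : ℝ) ≤ ∏ p ∈ {2, 3, 5, 7}, auxFactor p := by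
    norm_num [auxFactor, resDensityBound, primDensity]
  rw [h1, h2]
  nlinarith

lemma mul_prod_primDensity_le {M : ℕ} (hM : 11 ≤ M) :
    0.3275 * ∏ p ∈ M.primesBelow, primDensity p ≤ ∏ p ∈ M.primesBelow, resDensity p := by
  refine le_trans ?_ (Finset.prod_le_prod (fun p hp => ?_)
    fun p hp => auxFactor_mul_le (Nat.prime_of_mem_primesBelow hp))
  · rw [Finset.prod_mul_distrib, Finset.prod_mul_distrib, Finset.prod_pow]
    refine mul_le_mul_of_nonneg_right ?_ (Finset.prod_nonneg fun p hp =>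
      (primDensity_pos (Nat.prime_of_mem_primesBelow hp)).le)
    have hpi : (0.6079 : ℝ) ≤ 6 / Real.pi ^ 2 := by
      rw [le_div_iff₀ (by positivity)]
      nlinarith [Real.pi_lt_d4, Real.pi_pos]
    have h1 := hpi.trans (six_div_pi_sq_le_prod M)
    have h2 := pow_le_pow_left₀ (by norm_num) h1 2
    refine le_trans ?_ (mul_le_mul (le_prod_auxFactor hM) h2 (by positivity)
      (le_trans (by norm_num) (le_prod_auxFactor hM)))
    norm_num
  · have hp' := Nat.prime_of_mem_primesBelow hp
    exact mul_nonneg (mul_nonneg (auxFactor_nonneg hp') (sq_nonneg _)) (primDensity_pos hp').le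

lemma six_div_pi_sq_le_prod_primDensity (M : ℕ) :
    6 / Real.pi ^ 2 ≤ ∏ p ∈ M.primesBelow, primDensity p := by
  refine (six_div_pi_sq_le_prod M).trans (Finset.prod_le_prod (fun p hp => ?_) fun p hp => ?_)
  · exact (one_sub_prime_pow_pos (Nat.prime_of_mem_primesBelow hp) two_ne_zero).le
  · have : (1 : ℝ) ≤ p := by exact_mod_cast (Nat.prime_of_mem_primesBelow hp).one_le
    exact sub_le_sub_left (one_div_le_one_div_of_le (by positivity)
      (pow_le_pow_right₀ this (by norm_num))) 1

lemma exists_tendsto_prod_primesBelow {f : ℕ → ℝ} (h0 : ∀ p, p.Prime → 0 ≤ f p)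
    (h1 : ∀ p, p.Prime → f p ≤ 1) :
    ∃ l, Tendsto (fun M : ℕ => ∏ p ∈ M.primesBelow, f p) atTop (nhds l) :=
  ⟨_, tendsto_atTop_ciInf (antitone_prod_primesBelow h0 h1) ⟨0, by
    rintro _ ⟨M, rfl⟩
    exact Finset.prod_nonneg fun p hp => h0 p (Nat.prime_of_mem_primesBelow hp)⟩⟩

end EulerProduct

section IteratedLimit

lemma liminf_limsup_mem_Icc {α : Type*} {l : Filter α} [l.NeBot] {f : α → ℝ} {a b : ℝ}
    (h : ∀ᶠ x in l, f x ∈ Set.Icc a b) :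
    liminf f l ∈ Set.Icc a b ∧ limsup f l ∈ Set.Icc a b := by
  have ha : ∀ᶠ x in l, a ≤ f x := h.mono fun _ hx => hx.1
  have hb : ∀ᶠ x in l, f x ≤ b := h.mono fun _ hx => hx.2
  have Ba : IsBoundedUnder (· ≥ ·) l f := ⟨a, eventually_map.2 ha⟩
  have Bb : IsBoundedUnder (· ≤ ·) l f := ⟨b, eventually_map.2 hb⟩
  have h1 := le_liminf_of_le Bb.isCoboundedUnder_ge ha
  have h2 := limsup_le_of_le Ba.isCoboundedUnder_le hb
  have h3 := liminf_le_limsup Bb Ba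
  exact ⟨⟨h1, h3.trans h2⟩, ⟨h1.trans h3, h2⟩⟩

lemma tendsto_pi_floor_atTop {ι : Type*} :
    Tendsto (fun (s : ι → ℝ) i => ⌊s i⌋₊) atTop atTop := by
  refine tendsto_atTop.2 fun N => ?_
  filter_upwards [eventually_ge_atTop fun i => (N i : ℝ)] with s hs i
  exact Nat.le_floor (hs i)

lemma tendsto_iterated_of_tendsto_iterAtTop {ι : Type*} [DecidableEq ι] {n : ι} {g : (ι → ℕ) → ℝ} {L : ℝ}
    (hg : Tendsto g (iterAtTop n) (nhds L)) {W : (ι → ℝ) → ℝ}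
    (hW : ∀ r, (∀ i, 0 ≤ r i) → W r = g fun i => ⌊r i⌋₊) :
    Tendsto (fun s => liminf (fun t : ℝ => W (Function.update s n t)) atTop) atTop (nhds L) ∧
    Tendsto (fun s => limsup (fun t : ℝ => W (Function.update s n t)) atTop) atTop (nhds L) := by
  have key : ∀ ε > 0, ∀ᶠ s : ι → ℝ in atTop, ∀ᶠ t : ℝ in atTop,
      W (Function.update s n t) ∈ Set.Icc (L - ε) (L + ε) := fun ε hε => by
    have h := eventually_iterAtTop.1 (hg (Icc_mem_nhds (sub_lt_self L hε) (lt_add_of_pos_right L hε)))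
    filter_upwards [tendsto_pi_floor_atTop.eventually h,
      eventually_ge_atTop (fun _ : ι => (0 : ℝ))] with s hs hs0
    filter_upwards [tendsto_nat_floor_atTop.eventually hs, eventually_ge_atTop (0 : ℝ)] with t ht ht0
    rw [hW]
    · convert ht using 2
      ext i
      by_cases hi : i = n
      · subst hi; simp
      · simp [hi]
    · intro i
      by_cases hi : i = n
      · subst hi; simpa using ht0
      · simpa [hi] using hs0 i
  constructor <;>
  · refine Metric.tendsto_nhds.2 fun ε hε => ?_
    filter_upwards [key (ε / 2) (half_pos hε)] with s hs
    have := liminf_limsup_mem_Icc hs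
    rw [Real.dist_eq, abs_lt]
    obtain ⟨⟨h1, h2⟩, h3, h4⟩ := this
    constructor <;> linarith

lemma tendsto_of_sieve {α : Type*} {l : Filter α} {g : α → ℝ} {h : ℕ → α → ℝ} {P : ℕ → ℝ}
    {L C : ℝ} (hP : Tendsto P atTop (nhds L)) (hh : ∀ M, Tendsto (h M) l (nhds (P M)))
    (hle : ∀ M a, g a ≤ h M a) (hge : ∀ M, 2 ≤ M → ∀ᶠ a in l, h M a ≤ g a + C / (M : ℝ)) :
    Tendsto g l (nhds L) := by
  refine Metric.tendsto_nhds.2 fun ε hε => ?_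
  have h3 : 0 < ε / 3 := by positivity
  obtain ⟨M, hM1, hM2, hM⟩ := ((Metric.tendsto_nhds.1 hP _ h3).and
    ((Metric.tendsto_nhds.1 (tendsto_const_div_atTop_nhds_zero_nat C) _ h3).and
      (eventually_ge_atTop 2))).exists
  filter_upwards [Metric.tendsto_nhds.1 (hh M) _ h3, hge M hM] with a ha hga
  have := hle M a
  rw [Real.dist_eq, abs_lt] at *
  constructor <;> linarith [hM1.1, hM1.2, hM2.1, hM2.2, ha.1, ha.2]

end IteratedLimit

section Densities

lemma redMod_apply_eq_zero_iff {ι : Type*} {m : ℕ} {x : ι → ℤ} :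
    redMod m x = 0 ↔ ∀ i, (m : ℤ) ∣ x i := by
  simp only [funext_iff, redMod, Pi.zero_apply, ZMod.intCast_zmod_eq_zero_iff_dvd]

lemma resEval_redMod_eq_zero_iff {m : ℕ} {x : Fin (2 * 2 + 2) → ℤ} :
    resEval 2 (redMod m x) = 0 ↔ (m : ℤ) ∣ resEval 2 x := by
  rw [← ZMod.intCast_zmod_eq_zero_iff_dvd, resEval_two, resEval_two]
  simp only [redMod]
  push_cast
  rfl

lemma squarefree_int_iff {a : ℤ} :
    Squarefree a ↔ a ≠ 0 ∧ ∀ p : ℕ, p.Prime → ¬ (p : ℤ) ^ 2 ∣ a := by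
  rw [← Int.squarefree_natAbs, Nat.squarefree_iff_prime_squarefree]
  have h : ∀ p : ℕ, (p : ℤ) ^ 2 ∣ a ↔ p * p ∣ a.natAbs := fun p => by
    rw [← sq, ← Int.natCast_dvd]; push_cast; rfl
  simp only [h]
  refine ⟨fun H => ⟨?_, H⟩, fun H => H.2⟩
  rintro rfl
  exact H 2 Nat.prime_two (by simp)

lemma gcd_eq_one_iff {ι : Type*} [Fintype ι] {x : ι → ℤ} :
    Finset.univ.gcd x = 1 ↔ ∀ p : ℕ, p.Prime → ∃ i, ¬ (p : ℤ) ∣ x i := by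
  constructor
  · intro h p hp
    by_contra! hall
    have := Finset.dvd_gcd fun i (_ : i ∈ Finset.univ) => hall i
    rw [h] at this
    exact hp.one_lt.ne' (by exact_mod_cast Int.eq_one_of_dvd_one (by positivity) this)
  · intro H
    rw [← Finset.normalize_gcd, normalize_eq_one, Int.isUnit_iff_natAbs_eq]
    by_contra hne
    obtain ⟨p, hp, hdvd⟩ := Nat.exists_prime_and_dvd hne
    obtain ⟨i, hi⟩ := H p hp
    exact hi ((Int.natCast_dvd.2 hdvd).trans (Finset.gcd_dvd (Finset.mem_univ i)))

lemma gcd_eq_one_of_squarefree {x : Fin (2 * 2 + 2) → ℤ} (h : Squarefree (resEval 2 x)) :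
    Finset.univ.gcd x = 1 := by
  refine gcd_eq_one_iff.2 fun p hp => ?_
  by_contra! hall
  choose y hy using hall
  refine (squarefree_int_iff.1 h).2 p hp ⟨p ^ 2 * resEval 2 y, ?_⟩
  rw [resEval_two, resEval_two]
  simp only [hy]
  ring

lemma pairwise_coprime_primesBelow (M k : ℕ) :
    Pairwise (Function.onFun Nat.Coprime fun p : M.primesBelow => (p : ℕ) ^ k) :=
  fun p q hpq => Nat.Coprime.pow _ _ ((Nat.coprime_primes (Nat.prime_of_mem_primesBelow p.2)
    (Nat.prime_of_mem_primesBelow q.2)).2 fun h => hpq (Subtype.ext h))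

lemma tendsto_dens_resEval (M : ℕ) :
    Tendsto (fun N => dens N fun x : Fin (2 * 2 + 2) → ℤ =>
      ∀ p ∈ M.primesBelow, ¬ (p : ℤ) ^ 2 ∣ resEval 2 x) atTop
      (nhds (∏ p ∈ M.primesBelow, resDensity p)) := by
  have h := tendsto_dens_forall_redMod_mem (fun p : M.primesBelow => (p : ℕ) ^ 2)
    (fun p => pow_ne_zero 2 (Nat.prime_of_mem_primesBelow p.2).ne_zero)
    (pairwise_coprime_primesBelow M 2)
    fun p => {Q : Fin (2 * 2 + 2) → ZMod ((p : ℕ) ^ 2) | resEval 2 Q ≠ 0}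
  rw [← Finset.prod_coe_sort]
  refine h.congr fun N => ?_
  congr 1
  ext x
  simp only [Set.mem_ofPred_eq, ne_eq, resEval_redMod_eq_zero_iff, Subtype.forall, Nat.cast_pow]

lemma primDensity_eq {p : ℕ} (hp : p ≠ 0) :
    primDensity p = Nat.card ({0}ᶜ : Set (Fin (2 * 2 + 2) → ZMod p)) /
      (p : ℝ) ^ Fintype.card (Fin (2 * 2 + 2)) := by
  have : NeZero p := ⟨hp⟩
  have h : Nat.card ({0}ᶜ : Set (Fin (2 * 2 + 2) → ZMod p)) = p ^ 6 - 1 := by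
    rw [Nat.card_coe_set_eq, Set.ncard_compl, Set.ncard_singleton, Nat.card_fun, Nat.card_zmod,
      Nat.card_eq_fintype_card, Fintype.card_fin]
  have h1 : 1 ≤ p ^ 6 := Nat.one_le_iff_ne_zero.2 (pow_ne_zero _ hp)
  have hp' : (p : ℝ) ≠ 0 := by exact_mod_cast hp
  rw [h, Nat.cast_sub h1, Fintype.card_fin, primDensity]
  push_cast
  field_simp

lemma tendsto_dens_redMod_ne_zero (M : ℕ) :
    Tendsto (fun N => dens N fun x : Fin (2 * 2 + 2) → ℤ =>
      ∀ p ∈ M.primesBelow, ∃ i, ¬ (p : ℤ) ∣ x i) atTop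
      (nhds (∏ p ∈ M.primesBelow, primDensity p)) := by
  have h := tendsto_dens_forall_redMod_mem (fun p : M.primesBelow => (p : ℕ))
    (fun p => (Nat.prime_of_mem_primesBelow p.2).ne_zero)
    (by simpa using pairwise_coprime_primesBelow M 1)
    fun p => ({0}ᶜ : Set (Fin (2 * 2 + 2) → ZMod p))
  rw [← Finset.prod_coe_sort, Finset.prod_congr rfl fun (p : M.primesBelow) _ =>
    primDensity_eq (Nat.prime_of_mem_primesBelow p.2).ne_zero]
  refine h.congr fun N => ?_
  congr 1
  ext x
  simp only [Set.mem_compl_iff, Set.mem_singleton_iff, redMod_apply_eq_zero_iff, Subtype.forall,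
    not_forall]

variable (n : Fin (2 * 2 + 2))

lemma tendsto_dens_squarefree {L : ℝ}
    (hL : Tendsto (fun M : ℕ => ∏ p ∈ M.primesBelow, resDensity p) atTop (nhds L)) :
    Tendsto (fun N => dens N fun x : Fin (2 * 2 + 2) → ℤ => Squarefree (resEval 2 x))
      (iterAtTop n) (nhds L) := by
  refine tendsto_of_sieve (C := 64) (hL.comp (tendsto_add_atTop_nat 1))
    (fun M => (tendsto_dens_resEval (M + 1)).mono_left (iterAtTop_le_atTop n))
    (fun M N => dens_mono fun x _ hx p hp =>
      (squarefree_int_iff.1 hx).2 p (Nat.prime_of_mem_primesBelow hp)) fun M hM => ?_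
  filter_upwards [eventually_dens_resEval_le n hM] with N hN
  refine (dens_mono fun x _ hx => ?_).trans ((dens_or_le N _ _).trans (add_le_add le_rfl hN))
  by_cases h0 : resEval 2 x = 0
  · exact Or.inr (Or.inl h0)
  by_cases hl : LargeSquareDvd M (resEval 2 x)
  · exact Or.inr hl
  refine Or.inl (squarefree_int_iff.2 ⟨h0, fun p hp hdvd => ?_⟩)
  by_cases hpM : p < M + 1
  · exact hx p (Nat.mem_primesBelow.2 ⟨hpM, hp⟩) hdvd
  · exact hl (Or.inr ⟨p, hp, by omega, hdvd⟩)

lemma tendsto_dens_gcd {L : ℝ}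
    (hL : Tendsto (fun M : ℕ => ∏ p ∈ M.primesBelow, primDensity p) atTop (nhds L)) :
    Tendsto (fun N => dens N fun x : Fin (2 * 2 + 2) → ℤ => Finset.univ.gcd x = 1)
      (iterAtTop n) (nhds L) := by
  refine tendsto_of_sieve (C := 3) (hL.comp (tendsto_add_atTop_nat 1))
    (fun M => (tendsto_dens_redMod_ne_zero (M + 1)).mono_left (iterAtTop_le_atTop n))
    (fun M N => dens_mono fun x _ hx p hp =>
      gcd_eq_one_iff.1 hx p (Nat.prime_of_mem_primesBelow hp)) fun M hM => ?_
  have hM0 : (0 : ℝ) < 1 / (M : ℝ) := by positivity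
  have hc : ∀ i : Fin (2 * 2 + 2), ∀ᶠ N : Fin (2 * 2 + 2) → ℕ in iterAtTop n,
      1 / (2 * (N i : ℝ) + 1) ≤ 1 / (M : ℝ) := fun i =>
    iterAtTop_le_atTop n ((tendsto_const_div_coord 1 i).eventually_le_const hM0)
  filter_upwards [hc 0, hc 1] with N h0 h1
  have hsplit : dens N (fun x : Fin (2 * 2 + 2) → ℤ =>
      ∀ p ∈ (M + 1).primesBelow, ∃ i, ¬ (p : ℤ) ∣ x i) ≤
      dens N (fun x => Finset.univ.gcd x = 1 ∨ x 0 = 0 ∨ x 1 = 0 ∨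
        ∃ p : ℕ, M < p ∧ (x 0 ≠ 0 ∧ (p : ℤ) ∣ x 0) ∧ (x 1 ≠ 0 ∧ (p : ℤ) ∣ x 1)) := by
    refine dens_mono fun x _ hx => ?_
    by_contra! hcon
    obtain ⟨hg, hx0, hx1, hp⟩ := hcon
    refine hg (gcd_eq_one_iff.2 fun p hpp => ?_)
    by_cases hpM : p < M + 1
    · exact hx p (Nat.mem_primesBelow.2 ⟨hpM, hpp⟩)
    · by_contra! hall
      exact hp p (by omega) ⟨hx0, hall 0⟩ hx1 (hall 1)
  have e1 := dens_or_le N (fun x : Fin (2 * 2 + 2) → ℤ => Finset.univ.gcd x = 1) fun x =>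
    x 0 = 0 ∨ x 1 = 0 ∨
      ∃ p : ℕ, M < p ∧ (x 0 ≠ 0 ∧ (p : ℤ) ∣ x 0) ∧ (x 1 ≠ 0 ∧ (p : ℤ) ∣ x 1)
  have e2 := dens_or_le N (fun x : Fin (2 * 2 + 2) → ℤ => x 0 = 0) fun x => x 1 = 0 ∨
      ∃ p : ℕ, M < p ∧ (x 0 ≠ 0 ∧ (p : ℤ) ∣ x 0) ∧ (x 1 ≠ 0 ∧ (p : ℤ) ∣ x 1)
  have e3 := dens_or_le N (fun x : Fin (2 * 2 + 2) → ℤ => x 1 = 0) fun x =>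
      ∃ p : ℕ, M < p ∧ (x 0 ≠ 0 ∧ (p : ℤ) ∣ x 0) ∧ (x 1 ≠ 0 ∧ (p : ℤ) ∣ x 1)
  have e4 := dens_exists_dvd_dvd_le N (i := 0) (j := 1) (by decide) (show M ≠ 0 by omega)
  have e5 := dens_eq_zero_le N 0
  have e6 := dens_eq_zero_le N 1
  have e7 : 3 / (M : ℝ) = 1 / (M : ℝ) + 1 / (M : ℝ) + 1 / (M : ℝ) := by ring
  linarith

end Densities

section Counting

variable {m : ℕ}

/-- The first nonzero coordinate of `x` is positive. -/
def LeadingPos (x : Fin m → ℤ) : Prop := ∃ i, 0 < x i ∧ ∀ j, j < i → x j = 0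

lemma leadingPos_or_neg {x : Fin m → ℤ} (hx : x ≠ 0) : LeadingPos x ∨ LeadingPos (-x) := by
  obtain ⟨i, hi⟩ := Function.ne_iff.1 hx
  obtain ⟨k, hk, hmin⟩ := WellFounded.has_min (wellFounded_lt (α := Fin m)) {i | x i ≠ 0} ⟨i, hi⟩
  have h0 : ∀ j, j < k → x j = 0 := fun j hj => by
    by_contra h
    exact hmin j h hj
  rcases lt_or_gt_of_ne (show x k ≠ 0 from hk) with h | h
  · exact Or.inr ⟨k, by simpa using h, fun j hj => by simp [h0 j hj]⟩
  · exact Or.inl ⟨k, h, h0⟩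

lemma LeadingPos.not_neg {x : Fin m → ℤ} (h : LeadingPos x) : ¬ LeadingPos (-x) := by
  obtain ⟨i, hi, hi'⟩ := h
  rintro ⟨k, hk, hk'⟩
  simp only [Pi.neg_apply, Left.neg_pos_iff, neg_eq_zero] at hk hk'
  rcases lt_trichotomy i k with h | rfl | h
  · exact hi.ne' (hk' i h)
  · exact lt_asymm hi hk
  · exact hk.ne (hi' k h)

lemma neg_mem_cube {N : Fin m → ℕ} {x : Fin m → ℤ} : -x ∈ cube N ↔ x ∈ cube N := by
  simp [mem_cube]

lemma two_mul_card_leadingPos {N : Fin m → ℕ} {P : (Fin m → ℤ) → Prop} (hneg : ∀ x, P x → P (-x))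
    (h0 : ¬ P 0) :
    2 * (Nat.card {x | (P x ∧ LeadingPos x) ∧ x ∈ cube N} : ℝ) = dens N P * (cube N).card := by
  classical
  rw [dens_eq, div_mul_cancel₀ _ (card_cube_pos N).ne']
  have hcard : Nat.card {x | (P x ∧ LeadingPos x) ∧ x ∈ cube N} =
      ((cube N).filter fun x => P x ∧ LeadingPos x).card := by
    rw [Nat.card_coe_set_eq, ← Set.ncard_coe_finset]
    congr 1
    ext x
    simp [and_comm]
  have hsplit := Finset.card_filter_add_card_filter_not (s := (cube N).filter P) LeadingPos
  have hsymm : (((cube N).filter P).filter fun x => ¬ LeadingPos x).card =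
      ((cube N).filter fun x => P x ∧ LeadingPos x).card := by
    refine Finset.card_bij' (fun x _ => -x) (fun x _ => -x) (fun x hx => ?_) (fun x hx => ?_)
      (fun x _ => neg_neg x) fun x _ => neg_neg x
    · simp only [Finset.mem_filter, neg_mem_cube] at hx ⊢
      refine ⟨hx.1.1, hneg x hx.1.2, (leadingPos_or_neg ?_).resolve_left hx.2⟩
      rintro rfl
      exact h0 hx.1.2
    · simp only [Finset.mem_filter, neg_mem_cube] at hx ⊢
      exact ⟨⟨hx.1, hneg x hx.2.1⟩, hx.2.2.not_neg⟩
  rw [Finset.filter_filter, hsymm, ← two_mul] at hsplit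
  rw [hcard]
  exact_mod_cast hsplit

lemma mem_box_iff {r : Fin m → ℝ} (hr : ∀ i, 0 ≤ r i) {x : Fin m → ℤ} :
    x ∈ box r ↔ x ∈ cube fun i => ⌊r i⌋₊ := by
  rw [mem_cube]
  refine forall_congr' fun i => ?_
  rw [← Int.cast_abs, Int.natCast_floor_eq_floor (hr i), Int.le_floor]

lemma resEval_two_neg (x : Fin (2 * 2 + 2) → ℤ) : resEval 2 (-x) = resEval 2 x := by
  rw [resEval_two, resEval_two]
  simp only [Pi.neg_apply]
  ring

lemma weakRatio_eq {r : Fin (2 * 2 + 2) → ℝ} (hr : ∀ i, 0 ≤ r i) :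
    weakRatio 2 sqfRes2 r =
      dens (fun i => ⌊r i⌋₊) (fun x : Fin (2 * 2 + 2) → ℤ => Squarefree (resEval 2 x)) /
      dens (fun i => ⌊r i⌋₊) fun x : Fin (2 * 2 + 2) → ℤ => Finset.univ.gcd x = 1 := by
  set N : Fin (2 * 2 + 2) → ℕ := fun i => ⌊r i⌋₊
  have h1 : sqfRes2 ∩ box r =
      {x | (Squarefree (resEval 2 x) ∧ LeadingPos x) ∧ x ∈ cube N} := by
    ext x
    simp only [Set.mem_inter_iff, mem_box_iff hr, Set.mem_ofPred_eq, sqfRes2, projPts]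
    exact ⟨fun h => ⟨⟨h.1.2, h.1.1.2⟩, h.2⟩,
      fun h => ⟨⟨⟨gcd_eq_one_of_squarefree h.1.1, h.1.2⟩, h.1.1⟩, h.2⟩⟩
  have h2 : projPts 2 ∩ box r =
      {x | (Finset.univ.gcd x = 1 ∧ LeadingPos x) ∧ x ∈ cube N} := by
    ext x
    simp only [Set.mem_inter_iff, mem_box_iff hr, Set.mem_ofPred_eq, projPts]
    rfl
  have c1 := two_mul_card_leadingPos (N := N)
    (P := fun x : Fin (2 * 2 + 2) → ℤ => Squarefree (resEval 2 x))
    (fun x hx => (resEval_two_neg x).symm ▸ hx) (by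
      rw [resEval_two]
      simp)
  have c2 := two_mul_card_leadingPos (N := N)
    (P := fun x : Fin (2 * 2 + 2) → ℤ => Finset.univ.gcd x = 1)
    (fun x hx => by simpa [gcd_eq_one_iff] using hx) (by
      rw [gcd_eq_one_iff]
      push Not
      exact ⟨2, Nat.prime_two, by simp⟩)
  rw [weakRatio, h1, h2, ← mul_div_mul_left _ _ (two_ne_zero (α := ℝ)), c1, c2,
    mul_div_mul_right _ _ (card_cube_pos N).ne']

end Counting

/-- for every `n`, the `n`-th weak box density of the set of degree-2
rational maps with squarefree resultant exists and exceeds `0.327`. -/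
theorem stmt_19 (n : Fin (2 * 2 + 2)) :
    ∃ L : ℝ,
      liminf (fun s : Fin (2 * 2 + 2) → ℝ =>
          liminf (fun t : ℝ => weakRatio 2 sqfRes2 (Function.update s n t)) atTop)
        atTop = L ∧
      limsup (fun s : Fin (2 * 2 + 2) → ℝ =>
          limsup (fun t : ℝ => weakRatio 2 sqfRes2 (Function.update s n t)) atTop)
        atTop = L ∧
      (0.327 : ℝ) < L := by
  obtain ⟨P, hP⟩ := exists_tendsto_prod_primesBelow (f := resDensity)
    (fun p _ => resDensity_nonneg p) fun p hp => resDensity_le_one p hp.ne_zero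
  obtain ⟨Z, hZ⟩ := exists_tendsto_prod_primesBelow (f := primDensity)
    (fun p hp => (primDensity_pos hp).le) fun p _ => primDensity_le_one p
  have hZ0 : 0 < Z := lt_of_lt_of_le (by positivity)
    (ge_of_tendsto' hZ six_div_pi_sq_le_prod_primDensity)
  have hPZ : 0.3275 * Z ≤ P := le_of_tendsto_of_tendsto (hZ.const_mul _) hP
    ((eventually_ge_atTop 11).mono fun M hM => mul_prod_primDensity_le hM)
  obtain ⟨hinf, hsup⟩ := tendsto_iterated_of_tendsto_iterAtTop
    ((tendsto_dens_squarefree n hP).div (tendsto_dens_gcd n hZ) hZ0.ne')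
    fun r hr => weakRatio_eq hr
  refine ⟨P / Z, hinf.liminf_eq, hsup.limsup_eq, ?_⟩
  rw [lt_div_iff₀ hZ0]
  linarith
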